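/- arXiv:1710.00282 — 4 statements merged into one kernel-verified Lean document; each statement's English description precedes it below -/
import Mathlib

section
/- Let 0 < a < 1. The Fourier transform of the Riesz potential V_a(r) = |r|^(−a), taken in the sense of tempered distributions, is given on ℝ∖{0} by ω ↦ 2 sin(aπ/2) Γ(1−a) / |2πω|^(1−a). -/
open Real MeasureTheory FourierTransform


lemma aux_int (k : ℝ) (hk1 : k < 1) (hk0 : 0 < k) (ψ : SchwartzMap ℝ ℂ) :
    Integrable (fun t : ℝ => |t| ^ (-k) * ‖ψ t‖) := by
  have h1 : Integrable (fun t : ℝ => (Set.Iic (1:ℝ)).indicator (fun y : ℝ => y ^ (-k)) ‖t‖) := by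
    rw [integrable_fun_norm_addHaar (μ := (volume : Measure ℝ))
      (f := (Set.Iic (1:ℝ)).indicator (fun y : ℝ => y ^ (-k)))]
    have h := intervalIntegral.intervalIntegrable_rpow' (a := 0) (b := 1) (r := -k) (by linarith)
    rw [intervalIntegrable_iff_integrableOn_Ioc_of_le zero_le_one] at h
    simp only [Module.finrank_self, Nat.sub_self, pow_zero, one_smul]
    rw [IntegrableOn, integrable_indicator_iff measurableSet_Iic, IntegrableOn,
      Measure.restrict_restrict measurableSet_Iic]
    have hset : Set.Iic (1:ℝ) ∩ Set.Ioi 0 = Set.Ioc 0 1 := by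
      ext x; simp [and_comm]
    rw [hset]; exact h
  obtain ⟨C, hC⟩ : ∃ C, ∀ t, ‖ψ t‖ ≤ C := by
    obtain ⟨C, hC⟩ := ψ.decay 0 0
    exact ⟨C, fun t => by simpa using hC.2 t⟩
  refine ((h1.mul_const C).add ψ.integrable.norm).mono' ?_ ?_
  · exact (Measurable.mul (by fun_prop) ψ.continuous.norm.measurable).aestronglyMeasurable
  · refine Filter.Eventually.of_forall fun t => ?_
    have hp : 0 ≤ |t| ^ (-k) := by positivity
    rw [Real.norm_of_nonneg (by positivity)]
    simp only [Pi.add_apply, Real.norm_eq_abs]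
    by_cases ht : |t| ≤ 1
    · rw [Set.indicator_of_mem (by exact ht)]
      have := mul_le_mul_of_nonneg_left (hC t) hp
      have := norm_nonneg (ψ t)
      linarith
    · rw [Set.indicator_of_notMem (by exact ht)]
      have : |t| ^ (-k) ≤ 1 := Real.rpow_le_one_of_one_le_of_nonpos (by linarith) (by linarith)
      have := mul_le_mul_of_nonneg_right this (norm_nonneg (ψ t))
      linarith

lemma aux_gamma (k : ℝ) (hk0 : 0 < k) (t : ℝ) (ht : t ≠ 0) :
    ∫ s in Set.Ioi (0:ℝ), s ^ (k/2 - 1) * exp (-(π * t^2 * s))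
      = Gamma (k/2) * π ^ (-(k/2)) * |t| ^ (-k) := by
  have h2 : 0 < t^2 := by positivity
  rw [Real.integral_rpow_mul_exp_neg_mul_Ioi (by linarith) (by positivity), one_div,
    Real.inv_rpow (by positivity), ← Real.rpow_neg (by positivity),
    Real.mul_rpow pi_pos.le h2.le, ← sq_abs, ← Real.rpow_natCast, ← Real.rpow_mul (abs_nonneg t)]
  have : ((2:ℕ):ℝ) * -(k/2) = -k := by push_cast; ring
  rw [this]; ring

lemma aux_fubini (k : ℝ) (hk0 : 0 < k) (hk1 : k < 1) (ψ : SchwartzMap ℝ ℂ) :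
    ∫ s in Set.Ioi (0:ℝ), ((s ^ (k/2 - 1) : ℝ) : ℂ) * ∫ t : ℝ, ((exp (-(π * t^2 * s)) : ℝ) : ℂ) * ψ t
      = ((Gamma (k/2) * π ^ (-(k/2)) : ℝ) : ℂ) * ∫ t : ℝ, ((|t| ^ (-k) : ℝ) : ℂ) * ψ t := by
  have hae : ∀ᵐ t : ℝ, t ≠ 0 := by
    simp [ae_iff]
  have hI : Integrable (Function.uncurry fun (s t : ℝ) =>
      ((s ^ (k/2 - 1) * exp (-(π * t^2 * s)) : ℝ) : ℂ) * ψ t)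
      ((volume.restrict (Set.Ioi (0:ℝ))).prod volume) := by
    have hm : Measurable (Function.uncurry fun (s t : ℝ) =>
      ((s ^ (k/2 - 1) * exp (-(π * t^2 * s)) : ℝ) : ℂ) * ψ t) := by
      have := ψ.continuous.measurable
      unfold Function.uncurry
      fun_prop
    rw [integrable_prod_iff' hm.aestronglyMeasurable]
    constructor
    · filter_upwards [hae] with t ht
      have h2 : 0 < t^2 := by positivity
      have := integrableOn_rpow_mul_exp_neg_mul_rpow (p := 1) (s := k/2-1) (b := π * t^2)
        (by linarith) one_pos (by positivity)
      simp only [Function.uncurry]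
      refine Integrable.mul_const (Integrable.ofReal (f := fun s : ℝ => s ^ (k/2 - 1) * exp (-(π * t^2 * s))) ?_) _
      simpa [IntegrableOn] using this
    · refine ((aux_int k hk1 hk0 ψ).const_mul (Gamma (k/2) * π ^ (-(k/2)))).congr ?_
      filter_upwards [hae] with t ht
      rw [← mul_assoc, ← aux_gamma k hk0 t ht, ← integral_mul_const]
      refine setIntegral_congr_fun measurableSet_Ioi fun s hs => ?_
      have hs' : (0:ℝ) < s := hs
      simp only [Function.uncurry, norm_mul, Complex.norm_real]
      rw [Real.norm_of_nonneg (by positivity), Real.norm_of_nonneg (by positivity)]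
  have h := integral_integral_swap hI
  rw [← integral_const_mul]
  calc _ = _ := by
        congr 1; ext s
        rw [← integral_const_mul]
        congr 1; ext t
        push_cast; ring
    _ = _ := h
    _ = _ := by
        apply integral_congr_ae
        filter_upwards [hae] with t ht
        rw [integral_mul_const, integral_complex_ofReal, aux_gamma k hk0 t ht]
        push_cast; ring

lemma aux_parseval (s : ℝ) (hs : 0 < s) (φ : SchwartzMap ℝ ℂ) :
    ∫ t : ℝ, ((exp (-(π * t^2 * s)) : ℝ) : ℂ) * 𝓕 φ t
      = ((s ^ (-(1/2) : ℝ) : ℝ) : ℂ) * ∫ t : ℝ, ((exp (-(π * t^2 * s⁻¹)) : ℝ) : ℂ) * φ t := by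
  have hs' : 0 < (s:ℂ).re := by simpa
  have hg : Integrable (fun x : ℝ => Complex.exp (-π * s * x^2)) := by
    have := (integrable_exp_neg_mul_sq (b := π * s) (by positivity)).ofReal (𝕜 := ℂ)
    refine this.congr (Filter.Eventually.of_forall fun x => ?_)
    simp
  have h := VectorFourier.integral_fourierIntegral_smul_eq_flip (L := innerₗ ℝ) (e := 𝐞)
    continuous_fourierChar continuous_inner hg (φ.integrable (μ := volume))
  have h' : ∫ x : ℝ, 𝓕 (fun x : ℝ => Complex.exp (-π * s * x^2)) x • φ x
     = ∫ x : ℝ, Complex.exp (-π * s * x^2) • 𝓕 (⇑φ) x := by simpa using! h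
  rw [fourier_gaussian_pi hs'] at h'
  rw [SchwartzMap.fourier_coe, ← integral_const_mul]
  simp only [smul_eq_mul] at h'
  refine Eq.trans ?_ (h'.symm.trans ?_)
  · congr 1; ext t; push_cast; ring_nf
  · congr 1; ext t
    rw [Complex.ofReal_cpow hs.le, ← mul_assoc, one_div ((s:ℂ)^_), ← Complex.cpow_neg]
    push_cast; ring_nf

lemma aux_const (a : ℝ) (ha0 : 0 < a) (ha1 : a < 1) :
    Gamma ((1-a)/2) * π ^ (-((1-a)/2)) =
    Gamma (a/2) * π ^ (-(a/2)) * (2 * sin (a * π / 2) * Gamma (1 - a) / (2 * π) ^ (1-a)) := by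
  have h1 := Real.Gamma_mul_Gamma_add_half ((1-a)/2)
  have h2 := Real.Gamma_mul_Gamma_one_sub (a/2)
  rw [show (1-a)/2 + 1/2 = 1 - a/2 by ring, show 2 * ((1-a)/2) = 1 - a by ring,
    show 1 - (1 - a) = a by ring] at h1
  rw [show π * (a/2) = a * π / 2 by ring] at h2
  have hs : 0 < sin (a * π / 2) := sin_pos_of_pos_of_lt_pi (by positivity) (by nlinarith [pi_pos])
  have hG : 0 < Gamma (1 - a/2) := Gamma_pos_of_pos (by linarith)
  rw [eq_div_iff hs.ne'] at h2
  rw [Real.mul_rpow (by norm_num) pi_pos.le]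
  have e1 : (2:ℝ)^(1-a) * 2 ^ a = 2 := by rw [← rpow_add two_pos]; simp
  have e2 : π ^ (-((1-a)/2)) * √π * π ^ (1-a) = π ^ (-(a/2)) * π := by
    rw [sqrt_eq_rpow, ← rpow_add pi_pos, ← rpow_add pi_pos, ← rpow_add_one pi_pos.ne']
    ring_nf
  have p1 : 0 < (2:ℝ)^(1-a) := by positivity
  have p2 : 0 < π^(1-a) := by positivity
  rw [← mul_left_inj' hG.ne', ← mul_left_inj' (mul_pos p1 p2).ne']
  have : Gamma (a / 2) * π ^ (-(a / 2)) * (2 * sin (a * π / 2) * Gamma (1 - a) / (2 ^ (1 - a) * π ^ (1 - a))) *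
        Gamma (1 - a / 2) * (2 ^ (1 - a) * π ^ (1 - a)) =
     (Gamma (a / 2) * Gamma (1 - a/2) * sin (a * π / 2)) * (π ^ (-(a / 2)) * 2 * Gamma (1 - a)) := by
    field_simp
  rw [this, h2]
  linear_combination π ^ (-((1-a)/2)) * (2 ^ (1 - a) * π ^ (1 - a)) * h1 + Gamma (1-a) * 2 * e2 + Gamma (1-a) * π ^ (-((1-a)/2)) * √π * π ^ (1-a) * e1

/-- The Fourier transform of the Riesz potential `V_a(r) = |r|^(-a)`, `0 < a < 1`, in the sense
of tempered distributions, is `ω ↦ 2 sin(aπ/2) Γ(1-a) / |2πω|^(1-a)`: tested against any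
Schwartz function `φ`, `⟨V_a, 𝓕 φ⟩ = ⟨g, φ⟩`. -/
theorem stmt9 (a : ℝ) (ha0 : 0 < a) (ha1 : a < 1) (φ : SchwartzMap ℝ ℂ) :
    ∫ t : ℝ, ((|t| ^ (-a) : ℝ) : ℂ) * 𝓕 (⇑φ) t =
      ∫ ω : ℝ, ((2 * Real.sin (a * Real.pi / 2) * Real.Gamma (1 - a) /
        |2 * Real.pi * ω| ^ (1 - a) : ℝ) : ℂ) * φ ω := by
  have h1 := aux_fubini a ha0 ha1 (𝓕 φ)
  have h2 := aux_fubini (1-a) (by linarith) (by linarith) φ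
  have h3 := integral_comp_rpow_Ioi (fun u : ℝ => ((u ^ ((1-a)/2 - 1) : ℝ) : ℂ) *
    ∫ t : ℝ, ((exp (-(π * t^2 * u)) : ℝ) : ℂ) * φ t) (p := -1) (by norm_num)
  have h4 : ∫ s in Set.Ioi (0:ℝ), ((s ^ (a/2 - 1) : ℝ) : ℂ) *
      ∫ t : ℝ, ((exp (-(π * t^2 * s)) : ℝ) : ℂ) * 𝓕 φ t =
      ∫ s in Set.Ioi (0:ℝ), ((s ^ ((1-a)/2 - 1) : ℝ) : ℂ) *
      ∫ t : ℝ, ((exp (-(π * t^2 * s)) : ℝ) : ℂ) * φ t := by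
    rw [← h3]
    refine setIntegral_congr_fun measurableSet_Ioi fun s hs => ?_
    have hs' : (0:ℝ) < s := hs
    simp only [aux_parseval s hs', Complex.real_smul, Real.rpow_neg_one]
    rw [← mul_assoc, ← mul_assoc, ← Complex.ofReal_mul, ← Complex.ofReal_mul]
    congr 2
    rw [← Real.rpow_neg_one s, ← Real.rpow_mul hs'.le, abs_neg, abs_one, one_mul,
      ← Real.rpow_add hs', ← Real.rpow_add hs']
    ring_nf
  rw [h1, h2, aux_const a ha0 ha1, Complex.ofReal_mul (Gamma (a/2) * π ^ (-(a/2))) (_ / _),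
    mul_assoc ((Gamma (a/2) * π ^ (-(a/2)) : ℝ) : ℂ)] at h4
  have hG : 0 < Gamma (a/2) := Gamma_pos_of_pos (by linarith)
  have hne : ((Gamma (a/2) * π ^ (-(a/2)) : ℝ) : ℂ) ≠ 0 := by
    rw [Complex.ofReal_ne_zero]; positivity
  have h5 := mul_left_cancel₀ hne h4
  rw [SchwartzMap.fourier_coe, ← integral_const_mul] at h5
  rw [h5]
  congr 1; ext ω
  rw [← mul_assoc, ← Complex.ofReal_mul, abs_mul, abs_of_pos (by positivity : 0 < 2 * π),
    Real.mul_rpow (by positivity) (abs_nonneg ω), Real.rpow_neg (abs_nonneg ω), ← div_div,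
    div_eq_mul_inv _ (|ω| ^ (1-a))]
end

section
/- For every t₀ ∈ (0,1) and a ∈ (0,1): the principal value integral p.v.∫₀¹ 1/((t−s)·s^(1−a)·|t₀−s|^a · 1_{(0,t₀)}(s)) ds equals (π/tan(aπ)) · t^(a−1) |t₀−t|^(−a) for 0 < t < t₀, and (π/sin(aπ)) · t^(a−1) |t₀−t|^(−a) for t₀ < t < 1. -/
open Real MeasureTheory Filter Set

/-- `pvIntegral f t L` means the principal value integral `p.v. ∫₀¹ f(s)/(t-s) ds` exists and
equals `L`, i.e. the integrals over `(0,1) \ (t-ε, t+ε)` converge to `L` as `ε → 0⁺`. -/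
def pvIntegral (f : ℝ → ℝ) (t L : ℝ) : Prop :=
  Tendsto (fun ε : ℝ => ∫ s in Set.Ioo (0:ℝ) 1 \ Set.Ioo (t - ε) (t + ε), f s / (t - s))
    (nhdsWithin 0 (Set.Ioi 0)) (nhds L)

lemma aux_cotsum (a : ℝ) (ha0 : 0 < a) (ha1 : a < 1) :
    Tendsto (fun N : ℕ => ∑ n ∈ Finset.range N, (1 / ((n:ℝ) + a) - 1 / ((n:ℝ) + 1 - a))) atTop
      (nhds (Real.pi / Real.tan (a * Real.pi))) := by
  have hx : (a : ℂ) ∈ Complex.integerComplement := by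
    rw [Complex.mem_integerComplement_iff]
    rintro ⟨n, hn⟩
    have h : (n : ℝ) = a := by exact_mod_cast hn
    have h1 : (0:ℝ) < n := by rw [h]; exact ha0
    have h2 : (n:ℝ) < 1 := by rw [h]; exact ha1
    have h1' : 0 < n := by exact_mod_cast h1
    have h2' : n < 1 := by exact_mod_cast h2
    omega
  have h := tendsto_logDeriv_euler_cot_sub hx
  have h2 : Tendsto (fun N : ℕ => ∑ j ∈ Finset.range N, (1 / (a - ((j:ℝ) + 1)) + 1 / (a + ((j:ℝ) + 1)))) atTop
      (nhds (Real.pi * Real.cot (Real.pi * a) - 1 / a)) := by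
    have h3 := (Complex.continuous_re.tendsto _).comp h
    have e : ((Real.pi : ℂ) * Complex.cot (Real.pi * a) - 1 / (a:ℂ)) = ((Real.pi * Real.cot (Real.pi * a) - 1 / a : ℝ) : ℂ) := by
      push_cast; rfl
    rw [e, Complex.ofReal_re] at h3
    refine h3.congr fun N => ?_
    have e2 : (∑ j ∈ Finset.range N, cotTerm (a:ℂ) j) = ((∑ j ∈ Finset.range N, (1 / (a - ((j:ℝ) + 1)) + 1 / (a + ((j:ℝ) + 1))) : ℝ) : ℂ) := by
      push_cast; rfl
    simp only [Function.comp]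
    rw [e2, Complex.ofReal_re]
  have h4 : Tendsto (fun N : ℕ => 1 / ((N:ℝ) + a)) atTop (nhds 0) := by
    refine tendsto_const_nhds.div_atTop ?_
    exact tendsto_atTop_add_const_right _ _ tendsto_natCast_atTop_atTop
  have h5 := (h2.const_add (1/a)).sub h4
  have e3 : 1 / a + (Real.pi * Real.cot (Real.pi * a) - 1 / a) - 0 = Real.pi / Real.tan (a * Real.pi) := by
    rw [Real.cot_eq_cos_div_sin, Real.tan_eq_sin_div_cos, mul_comm a]
    rw [div_div_eq_mul_div]; ring
  rw [e3] at h5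
  refine h5.congr fun N => ?_
  induction N with
  | zero => simp
  | succ N ih =>
    rw [Finset.sum_range_succ, Finset.sum_range_succ, ← ih]
    have : (1:ℝ) / (a - (N+1)) = - (1 / (N + 1 - a)) := by
      rw [← one_div_neg_eq_neg_one_div]; ring_nf
    rw [this]; push_cast; ring

lemma aux_rpow_int (p : ℝ) (hp : -1 < p) (b : ℝ) (hb : 0 ≤ b) :
    IntegrableOn (fun x : ℝ => x ^ p) (Ioo 0 b) := by
  rcases hb.eq_or_lt with rfl | hb
  · simp
  · rwa [intervalIntegral.integrableOn_Ioo_rpow_iff hb]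

lemma aux_bound (a x : ℝ) (ha0 : 0 < a) (ha1 : a < 1) (hx0 : 0 < x) (hx1 : x < 1) :
    |(x ^ (a - 1) - x ^ (-a)) / (1 - x)| ≤ x ^ (a - 1) + x ^ (-a) := by
  have key : ∀ p q : ℝ, p ≤ q → q ≤ p + 1 → |x ^ p - x ^ q| ≤ (1 - x) * x ^ p := by
    intro p q h1 h2
    have h3 := Real.rpow_le_rpow_of_exponent_ge hx0 hx1.le h1
    have h4 := Real.rpow_le_rpow_of_exponent_ge hx0 hx1.le h2
    rw [Real.rpow_add hx0, Real.rpow_one] at h4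
    rw [abs_of_nonneg (by linarith)]; linarith
  have p1 := Real.rpow_pos_of_pos hx0 (a - 1)
  have p2 := Real.rpow_pos_of_pos hx0 (-a)
  have hx : 0 < 1 - x := by linarith
  rw [abs_div, abs_of_pos hx, div_le_iff₀ hx]
  rcases le_total (a-1) (-a) with h | h
  · have := key _ _ h (by linarith)
    nlinarith
  · have := key _ _ h (by linarith)
    rw [abs_sub_comm] at this
    nlinarith

lemma aux_K_int (a : ℝ) (ha0 : 0 < a) (ha1 : a < 1) :
    IntegrableOn (fun x : ℝ => (x ^ (a - 1) - x ^ (-a)) / (1 - x)) (Ioo 0 1) := by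
  have h1 := aux_rpow_int (a-1) (by linarith) 1 zero_le_one
  have h2 := aux_rpow_int (-a) (by linarith) 1 zero_le_one
  refine Integrable.mono' (h1.add h2) ?_ ?_
  · exact (by fun_prop : Measurable (fun x : ℝ => (x ^ (a - 1) - x ^ (-a)) / (1 - x))).aestronglyMeasurable
  · refine (ae_restrict_iff' measurableSet_Ioo).2 (Eventually.of_forall fun x hx => ?_)
    exact aux_bound a x ha0 ha1 hx.1 hx.2

lemma aux_rpow_val (p : ℝ) (hp : -1 < p) : ∫ x in Ioo (0:ℝ) 1, x ^ p = 1 / (p + 1) := by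
  rw [← integral_Ioc_eq_integral_Ioo, ← intervalIntegral.integral_of_le zero_le_one,
    integral_rpow (Or.inl hp), Real.one_rpow, Real.zero_rpow (by linarith), sub_zero]

lemma aux_K_val (a : ℝ) (ha0 : 0 < a) (ha1 : a < 1) :
    ∫ x in Ioo (0:ℝ) 1, (x ^ (a - 1) - x ^ (-a)) / (1 - x) = Real.pi / Real.tan (a * Real.pi) := by
  refine tendsto_nhds_unique ?_ (aux_cotsum a ha0 ha1)
  have hK := aux_K_int a ha0 ha1
  have e : ∀ N : ℕ, ∑ n ∈ Finset.range N, (1 / ((n:ℝ) + a) - 1 / ((n:ℝ) + 1 - a))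
      = ∫ x in Ioo (0:ℝ) 1, (x ^ (a - 1) - x ^ (-a)) / (1 - x) * (1 - x ^ N) := by
    intro N
    have : ∀ x ∈ Ioo (0:ℝ) 1, (x ^ (a - 1) - x ^ (-a)) / (1 - x) * (1 - x ^ N) =
        ∑ n ∈ Finset.range N, (x ^ ((n:ℝ) + a - 1) - x ^ ((n:ℝ) - a)) := by
      intro x hx
      have h1 : ∀ n : ℕ, x ^ ((n:ℝ) + a - 1) - x ^ ((n:ℝ) - a) = (x ^ (a - 1) - x ^ (-a)) * x ^ n := by
        intro n
        rw [show (n:ℝ) + a - 1 = (a - 1) + n by ring, show (n:ℝ) - a = -a + n by ring,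
          Real.rpow_add hx.1, Real.rpow_add hx.1, Real.rpow_natCast]; ring
      simp_rw [h1]
      rw [← Finset.mul_sum, geom_sum_eq hx.2.ne]
      have : 1 - x ≠ 0 := by linarith [hx.2]
      have : x - 1 ≠ 0 := by linarith [hx.2]
      field_simp; ring
    rw [setIntegral_congr_fun measurableSet_Ioo this]
    have i1 : ∀ n : ℕ, IntegrableOn (fun x : ℝ => x ^ ((n:ℝ) + a - 1)) (Ioo 0 1) := fun n =>
      aux_rpow_int _ (by have := n.cast_nonneg (α := ℝ); linarith) 1 zero_le_one
    have i2 : ∀ n : ℕ, IntegrableOn (fun x : ℝ => x ^ ((n:ℝ) - a)) (Ioo 0 1) := fun n =>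
      aux_rpow_int _ (by have := n.cast_nonneg (α := ℝ); linarith) 1 zero_le_one
    have i3 : ∀ n : ℕ, IntegrableOn (fun x : ℝ => x ^ ((n:ℝ) + a - 1) - x ^ ((n:ℝ) - a)) (Ioo 0 1) :=
      fun n => (i1 n).sub (i2 n)
    rw [integral_finsetSum _ (fun n _ => i3 n)]
    refine Finset.sum_congr rfl fun n _ => ?_
    have := n.cast_nonneg (α := ℝ)
    rw [integral_sub (i1 n) (i2 n), aux_rpow_val _ (by linarith), aux_rpow_val _ (by linarith)]
    ring_nf
  simp_rw [e]
  refine tendsto_integral_of_dominated_convergence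
    (fun x => ‖(x ^ (a - 1) - x ^ (-a)) / (1 - x)‖) ?_ hK.norm ?_ ?_
  · intro N
    exact (by fun_prop : Measurable (fun x : ℝ => (x ^ (a - 1) - x ^ (-a)) / (1 - x) * (1 - x ^ N))).aestronglyMeasurable
  · intro N
    refine (ae_restrict_iff' measurableSet_Ioo).2 (Eventually.of_forall fun x hx => ?_)
    rw [norm_mul]
    refine mul_le_of_le_one_right (norm_nonneg _) ?_
    have h1 := pow_nonneg hx.1.le N
    have h2 := pow_le_one₀ hx.1.le hx.2.le (n := N)
    rw [Real.norm_eq_abs, abs_le]; constructor <;> linarith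
  · refine (ae_restrict_iff' measurableSet_Ioo).2 (Eventually.of_forall fun x hx => ?_)
    have := (tendsto_pow_atTop_nhds_zero_of_lt_one hx.1.le hx.2).const_sub 1
    simpa using this.const_mul ((x ^ (a - 1) - x ^ (-a)) / (1 - x))

lemma aux_beta (a : ℝ) (ha0 : 0 < a) (ha1 : a < 1) :
    ∫ x in Ioo (0:ℝ) 1, x ^ (a - 1) * (1 - x) ^ (-a) = Real.pi / Real.sin (a * Real.pi) := by
  have h := Complex.Gamma_mul_Gamma_eq_betaIntegral (s := (a:ℂ)) (t := 1 - (a:ℂ)) (by simpa) (by simpa)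
  rw [Complex.Gamma_mul_Gamma_one_sub, add_sub_cancel, Complex.Gamma_one, one_mul,
    Complex.betaIntegral, intervalIntegral.integral_of_le zero_le_one, integral_Ioc_eq_integral_Ioo] at h
  have e : ∀ x ∈ Ioo (0:ℝ) 1, (x:ℂ) ^ ((a:ℂ) - 1) * (1 - (x:ℂ)) ^ ((1:ℂ) - a - 1) =
      ((x ^ (a - 1) * (1 - x) ^ (-a) : ℝ) : ℂ) := by
    intro x hx
    push_cast
    rw [Complex.ofReal_cpow hx.1.le, Complex.ofReal_cpow (by linarith [hx.2])]
    push_cast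
    congr 2; ring
  rw [setIntegral_congr_fun measurableSet_Ioo e, integral_complex_ofReal] at h
  rw [mul_comm a]
  exact_mod_cast h.symm

lemma aux_core (a A B c x y D : ℝ) (hA : 0 < A) (hB : 0 < B) (hc : 0 < c) (hx : 0 < x) (hy : 0 < y)
    (hD : 0 < D) :
    (c * A * x / D) ^ (-(1 - a)) * |c * B * y / D| ^ (-a) =
      A ^ (-(1 - a)) * B ^ (-a) * (x ^ (a - 1) * y ^ (-a)) * D / c := by
  rw [abs_of_pos (by positivity)]
  rw [Real.div_rpow (by positivity) hD.le, Real.div_rpow (by positivity) hD.le,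
    Real.mul_rpow (by positivity) hx.le, Real.mul_rpow (by positivity) hy.le,
    Real.mul_rpow hc.le hA.le, Real.mul_rpow hc.le hB.le]
  have e : ∀ z : ℝ, 0 < z → z ^ (-(1 - a)) * z ^ (-a) * z = 1 := by
    intro z hz
    rw [← Real.rpow_add hz, show -(1 - a) + -a = -1 by ring, Real.rpow_neg_one,
      inv_mul_cancel₀ hz.ne']
  have e1 := e c hc
  have e2 := e D hD
  have d1 : 0 < D ^ (-(1 - a)) := Real.rpow_pos_of_pos hD _
  have d2 : 0 < D ^ (-a) := Real.rpow_pos_of_pos hD _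
  rw [show a - 1 = -(1 - a) by ring]
  generalize D ^ (-(1 - a)) = D1 at *
  generalize D ^ (-a) = D2 at *
  generalize c ^ (-(1 - a)) = c1 at *
  generalize c ^ (-a) = c2 at *
  generalize A ^ (-(1 - a)) = A1 at *
  generalize B ^ (-a) = A2 at *
  generalize x ^ (-(1 - a)) = A3 at *
  generalize y ^ (-a) = A4 at *
  field_simp
  linear_combination (A1 * A2 * A3 * A4) * e1 - (A1 * A2 * A3 * A4) * e2

lemma aux_cov (f f' v g h : ℝ → ℝ) (C : ℝ) (S T : Set ℝ) (hS : MeasurableSet S)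
    (hd : ∀ x ∈ S, HasDerivAt f (f' x) x) (h1 : ∀ x ∈ S, f x ∈ T ∧ v (f x) = x)
    (h2 : ∀ s ∈ T, v s ∈ S ∧ f (v s) = s) (hg : ∀ x ∈ S, |f' x| * g (f x) = C * h x) :
    (∫ s in T, g s) = C * ∫ x in S, h x ∧ (IntegrableOn h S → IntegrableOn g T) := by
  have him : f '' S = T := by
    ext s; constructor
    · rintro ⟨x, hx, rfl⟩; exact (h1 x hx).1
    · intro hs; exact ⟨v s, (h2 s hs).1, (h2 s hs).2⟩
  have hinj : InjOn f S := by
    intro x hx y hy hxy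
    rw [← (h1 x hx).2, ← (h1 y hy).2, hxy]
  have hd' : ∀ x ∈ S, HasDerivWithinAt f (f' x) S x := fun x hx => (hd x hx).hasDerivWithinAt
  rw [← him]
  constructor
  · rw [integral_image_eq_integral_abs_deriv_smul hS hd' hinj, ← integral_const_mul]
    exact setIntegral_congr_fun hS hg
  · intro hi
    rw [integrableOn_image_iff_integrableOn_abs_deriv_smul hS hd' hinj]
    exact IntegrableOn.congr_fun (Integrable.const_mul hi C) (fun x hx => (hg x hx).symm) hS


lemma aux_left (a t c b : ℝ) (ht : 0 < t) (htc : t < c) (hb : 0 < b) (hbt : b < t) :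
    (∫ s in Ioo 0 b, s ^ (-(1 - a)) * |c - s| ^ (-a) / (t - s)) =
      (t ^ (-(1 - a)) * |c - t| ^ (-a)) *
        ∫ x in Ioo 0 (b * (c - t) / (t * (c - b))), x ^ (a - 1) / (1 - x) ∧
    (IntegrableOn (fun x : ℝ => x ^ (a - 1) / (1 - x)) (Ioo 0 (b * (c - t) / (t * (c - b)))) →
      IntegrableOn (fun s => s ^ (-(1 - a)) * |c - s| ^ (-a) / (t - s)) (Ioo 0 b)) := by
  have hB : 0 < c - t := by linarith
  have hcb : 0 < c - b := by linarith
  have hc : 0 < c := by linarith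
  have hle : b * (c - t) / (t * (c - b)) < 1 := by
    rw [div_lt_one (by positivity)]; nlinarith
  refine aux_cov (fun x => c * t * x / ((c - t) + t * x))
    (fun x => c * t * (c - t) / ((c - t) + t * x) ^ 2)
    (fun s => s * (c - t) / (t * (c - s))) _ _ _ _ _ measurableSet_Ioo ?_ ?_ ?_ ?_
  · intro x hx
    have hD : 0 < (c - t) + t * x := by have := mul_pos ht hx.1; linarith
    have h1 : HasDerivAt (fun x => c * t * x) (c * t) x := by
      simpa using (hasDerivAt_id x).const_mul (c * t)
    have h2 : HasDerivAt (fun x => (c - t) + t * x) t x := by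
      simpa using ((hasDerivAt_id x).const_mul t).const_add (c - t)
    refine (h1.div h2 hD.ne').congr_deriv ?_
    congr 1; ring
  · intro x hx
    have hx0 := hx.1
    have hD : 0 < (c - t) + t * x := by have := mul_pos ht hx.1; linarith
    have hx2 := hx.2
    rw [lt_div_iff₀ (by positivity)] at hx2
    refine ⟨⟨by positivity, ?_⟩, ?_⟩
    · rw [div_lt_iff₀ hD]; nlinarith
    · have : c - c * t * x / ((c - t) + t * x) = c * (c - t) / ((c - t) + t * x) := by
        field_simp; ring
      simp only [this]
      field_simp
  · intro s hs
    have h0 := hs.1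
    have h3 : 0 < c - s := by linarith [hs.2]
    refine ⟨⟨by positivity, ?_⟩, ?_⟩
    · rw [div_lt_div_iff₀ (by positivity) (by positivity)]
      have : 0 < (c - t) * t * c * (b - s) := by
        have : 0 < b - s := by linarith [hs.2]
        positivity
      nlinarith
    · have : (c - t) + t * (s * (c - t) / (t * (c - s))) = c * (c - t) / (c - s) := by
        field_simp; ring
      simp only [this]
      field_simp
  · intro x hx
    have hx0 := hx.1
    have hx1 : 0 < 1 - x := by linarith [hx.2]
    have hD : 0 < (c - t) + t * x := by have := mul_pos ht hx.1; linarith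
    have e1 : c - c * t * x / ((c - t) + t * x) = c * (c - t) * 1 / ((c - t) + t * x) := by
      field_simp; ring
    have e2 : t - c * t * x / ((c - t) + t * x) = t * (c - t) * (1 - x) / ((c - t) + t * x) := by
      field_simp; ring
    simp only [e1, e2]
    rw [aux_core a t (c - t) c x 1 _ ht hB hc hx0 one_pos hD, abs_of_pos (by positivity),
      abs_of_pos hB, Real.one_rpow]
    field_simp

lemma aux_right (a t c b : ℝ) (ht : 0 < t) (htb : t < b) (hbc : b < c) :
    (∫ s in Ioo b c, s ^ (-(1 - a)) * |c - s| ^ (-a) / (t - s)) =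
      (-(t ^ (-(1 - a)) * |c - t| ^ (-a))) *
        ∫ x in Ioo 0 (t * (c - b) / (b * (c - t))), x ^ (-a) / (1 - x) ∧
    (IntegrableOn (fun x : ℝ => x ^ (-a) / (1 - x)) (Ioo 0 (t * (c - b) / (b * (c - t)))) →
      IntegrableOn (fun s => s ^ (-(1 - a)) * |c - s| ^ (-a) / (t - s)) (Ioo b c)) := by
  have hB : 0 < c - t := by linarith
  have hcb : 0 < c - b := by linarith
  have hc : 0 < c := by linarith
  have hb : 0 < b := by linarith
  have hle : t * (c - b) / (b * (c - t)) < 1 := by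
    rw [div_lt_one (by positivity)]; nlinarith
  refine aux_cov (fun x => c * t / ((c - t) * x + t))
    (fun x => - (c * t * (c - t) / ((c - t) * x + t) ^ 2))
    (fun s => t * (c - s) / (s * (c - t))) _ _ _ _ _ measurableSet_Ioo ?_ ?_ ?_ ?_
  · intro x hx
    have hD : 0 < (c - t) * x + t := by have := mul_pos hB hx.1; linarith
    have h2 : HasDerivAt (fun x => (c - t) * x + t) (c - t) x := by
      simpa using ((hasDerivAt_id x).const_mul (c - t)).add_const t
    refine ((hasDerivAt_const x (c * t)).div h2 hD.ne').congr_deriv ?_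
    rw [← neg_div]; congr 1; ring
  · intro x hx
    have hx0 := hx.1
    have hD : 0 < (c - t) * x + t := by have := mul_pos hB hx.1; linarith
    have hx2 := hx.2
    rw [lt_div_iff₀ (by positivity)] at hx2
    refine ⟨⟨?_, ?_⟩, ?_⟩
    · rw [lt_div_iff₀ hD]; nlinarith
    · rw [div_lt_iff₀ hD]; nlinarith [mul_pos hc (mul_pos hB hx0)]
    · have : c - c * t / ((c - t) * x + t) = c * (c - t) * x / ((c - t) * x + t) := by
        field_simp; ring
      simp only [this]
      field_simp
  · intro s hs
    have h0 : 0 < s := by linarith [hs.1]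
    have h3 : 0 < c - s := by linarith [hs.2]
    refine ⟨⟨by positivity, ?_⟩, ?_⟩
    · rw [div_lt_div_iff₀ (by positivity) (by positivity)]
      have : 0 < (c - t) * t * c * (s - b) := by
        have : 0 < s - b := by linarith [hs.1]
        positivity
      nlinarith
    · have : (c - t) * (t * (c - s) / (s * (c - t))) + t = c * t / s := by
        field_simp; ring
      simp only [this]
      field_simp
  · intro x hx
    have hx0 := hx.1
    have hx1 : 0 < 1 - x := by linarith [hx.2]
    have hD : 0 < (c - t) * x + t := by have := mul_pos hB hx.1; linarith
    have e0 : c * t / ((c - t) * x + t) = c * t * 1 / ((c - t) * x + t) := by ring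
    have e1 : c - c * t * 1 / ((c - t) * x + t) = c * (c - t) * x / ((c - t) * x + t) := by
      field_simp; ring
    have e2 : t - c * t * 1 / ((c - t) * x + t) = - (t * (c - t) * (1 - x) / ((c - t) * x + t)) := by
      field_simp; ring
    simp only [e0, e1, e2]
    rw [aux_core a t (c - t) c 1 x _ ht hB hc one_pos hx0 hD, abs_neg, abs_of_pos (by positivity),
      abs_of_pos hB, Real.one_rpow]
    field_simp

lemma aux_out (a t c : ℝ) (hc : 0 < c) (htc : c < t) :
    (∫ s in Ioo 0 c, s ^ (-(1 - a)) * |c - s| ^ (-a) / (t - s)) =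
      (t ^ (-(1 - a)) * |c - t| ^ (-a)) *
        ∫ x in Ioo (0:ℝ) 1, x ^ (a - 1) * (1 - x) ^ (-a) := by
  have hB : 0 < t - c := by linarith
  have ht : 0 < t := by linarith
  refine (aux_cov (fun x => c * t * x / ((t - c) + c * x))
    (fun x => c * t * (t - c) / ((t - c) + c * x) ^ 2)
    (fun s => s * (t - c) / (c * (t - s))) _ _ _ _ _ measurableSet_Ioo ?_ ?_ ?_ ?_).1
  · intro x hx
    have hD : 0 < (t - c) + c * x := by have := mul_pos hc hx.1; linarith
    have h1 : HasDerivAt (fun x => c * t * x) (c * t) x := by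
      simpa using (hasDerivAt_id x).const_mul (c * t)
    have h2 : HasDerivAt (fun x => (t - c) + c * x) c x := by
      simpa using ((hasDerivAt_id x).const_mul c).const_add (t - c)
    refine (h1.div h2 hD.ne').congr_deriv ?_
    congr 1; ring
  · intro x hx
    have hx0 := hx.1
    have hD : 0 < (t - c) + c * x := by have := mul_pos hc hx.1; linarith
    have hx2 := hx.2
    refine ⟨⟨by positivity, ?_⟩, ?_⟩
    · rw [div_lt_iff₀ hD]
      have : 0 < c * ((t - c) * (1 - x)) := mul_pos hc (mul_pos hB (by linarith))
      nlinarith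
    · have : t - c * t * x / ((t - c) + c * x) = t * (t - c) / ((t - c) + c * x) := by
        field_simp; ring
      simp only [this]
      field_simp
  · intro s hs
    have h0 := hs.1
    have h3 : 0 < t - s := by linarith [hs.2]
    refine ⟨⟨by positivity, ?_⟩, ?_⟩
    · rw [div_lt_one (by positivity)]
      have : 0 < t * (c - s) := by
        have : 0 < c - s := by linarith [hs.2]
        positivity
      nlinarith
    · have : (t - c) + c * (s * (t - c) / (c * (t - s))) = t * (t - c) / (t - s) := by
        field_simp; ring
      simp only [this]
      field_simp
  · intro x hx
    have hx0 := hx.1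
    have hx1 : 0 < 1 - x := by linarith [hx.2]
    have hD : 0 < (t - c) + c * x := by have := mul_pos hc hx.1; linarith
    have e1 : c - c * t * x / ((t - c) + c * x) = c * (t - c) * (1 - x) / ((t - c) + c * x) := by
      field_simp; ring
    have e2 : t - c * t * x / ((t - c) + c * x) = t * (t - c) / ((t - c) + c * x) := by
      field_simp; ring
    simp only [e1, e2]
    rw [aux_core a t (t - c) c x (1 - x) _ ht hB hc hx0 hx1 hD, abs_of_pos (by positivity),
      abs_sub_comm c t, abs_of_pos hB]
    field_simp

lemma aux_piece_int (p b : ℝ) (hp : -1 < p) (hb0 : 0 ≤ b) (hb : b < 1) :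
    IntegrableOn (fun x : ℝ => x ^ p / (1 - x)) (Ioo 0 b) := by
  refine Integrable.mono' ((aux_rpow_int p hp b hb0).mul_const (1 - b)⁻¹) ?_ ?_
  · exact (by fun_prop : Measurable (fun x : ℝ => x ^ p / (1 - x))).aestronglyMeasurable
  · refine (ae_restrict_iff' measurableSet_Ioo).2 (Eventually.of_forall fun x hx => ?_)
    have h1 : 0 < 1 - x := by linarith [hx.2]
    have h2 := Real.rpow_pos_of_pos hx.1 p
    rw [Real.norm_eq_abs, abs_of_pos (by positivity), div_eq_mul_inv]
    have h3 : 0 < 1 - b := by linarith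
    have h4 : 1 - b ≤ 1 - x := by linarith [hx.2]
    gcongr

lemma aux_piece_ii (p b : ℝ) (hp : -1 < p) (hb0 : 0 ≤ b) (hb : b < 1) :
    IntervalIntegrable (fun x : ℝ => x ^ p / (1 - x)) volume 0 b := by
  rw [intervalIntegrable_iff_integrableOn_Ioo_of_le hb0]
  exact aux_piece_int p b hp hb0 hb

lemma aux_II (f : ℝ → ℝ) (b : ℝ) (hb : 0 ≤ b) : ∫ x in Ioo 0 b, f x = ∫ x in (0:ℝ)..b, f x := by
  rw [intervalIntegral.integral_of_le hb, integral_Ioc_eq_integral_Ioo]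

lemma aux_diff (a α γ m : ℝ) (ha0 : 0 < a) (ha1 : a < 1) (hm : 0 < m) (hα : 1 / 2 ≤ α)
    (hγ : 1 / 2 ≤ γ) (hα1 : m ≤ 1 - α) (hγ1 : m ≤ 1 - γ) :
    |∫ x in γ..α, x ^ (-a) / (1 - x)| ≤ 2 / m * |α - γ| := by
  rw [← Real.norm_eq_abs]
  refine intervalIntegral.norm_integral_le_of_norm_le_const (E := ℝ) fun x hx => ?_
  rw [mem_uIoc] at hx
  have hx0 : 1 / 2 ≤ x := by rcases hx with h | h <;> linarith [h.1]
  have hx1 : m ≤ 1 - x := by rcases hx with h | h <;> linarith [h.2]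
  have hxp : 0 < x := by linarith
  have h1 : x ^ (-a) ≤ 2 := by
    calc x ^ (-a) ≤ x ^ (-1 : ℝ) :=
          Real.rpow_le_rpow_of_exponent_ge hxp (by linarith) (by linarith)
      _ = x⁻¹ := Real.rpow_neg_one x
      _ ≤ 2 := by rw [inv_le_comm₀ hxp two_pos]; linarith
  have h2 := Real.rpow_pos_of_pos hxp (-a)
  have h3 : 0 < 1 - x := by linarith
  rw [Real.norm_eq_abs, abs_of_pos (by positivity)]
  gcongr

lemma aux_limit (a t c : ℝ) (ha0 : 0 < a) (ha1 : a < 1) (ht : 0 < t) (htc : t < c) :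
    Tendsto (fun ε : ℝ =>
      (∫ x in Ioo 0 ((t - ε) * (c - t) / (t * (c - (t - ε)))), x ^ (a - 1) / (1 - x)) -
      ∫ x in Ioo 0 (t * (c - (t + ε)) / ((t + ε) * (c - t))), x ^ (-a) / (1 - x))
      (nhdsWithin 0 (Ioi 0)) (nhds (Real.pi / Real.tan (a * Real.pi))) := by
  have hB : 0 < c - t := by linarith
  have hc : 0 < c := by linarith
  set α : ℝ → ℝ := fun ε => (t - ε) * (c - t) / (t * (c - (t - ε))) with hαdef
  set γ : ℝ → ℝ := fun ε => t * (c - (t + ε)) / ((t + ε) * (c - t)) with hγdef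
  have tα : Tendsto α (nhdsWithin 0 (Ioi 0)) (nhds 1) := by
    have : ContinuousAt α 0 := by
      refine ContinuousAt.div (by fun_prop) (by fun_prop) ?_
      simp only [sub_zero]; positivity
    have h2 : α 0 = 1 := by simp only [hαdef, sub_zero]; field_simp
    rw [← h2]; exact this.tendsto.mono_left nhdsWithin_le_nhds
  have tγ : Tendsto γ (nhdsWithin 0 (Ioi 0)) (nhds 1) := by
    have : ContinuousAt γ 0 := by
      refine ContinuousAt.div (by fun_prop) (by fun_prop) ?_
      simp only [add_zero]; positivity
    have h2 : γ 0 = 1 := by simp only [hγdef, add_zero]; field_simp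
    rw [← h2]; exact this.tendsto.mono_left nhdsWithin_le_nhds
  have hpos : ∀ᶠ ε in nhdsWithin (0:ℝ) (Ioi 0), 0 < ε := eventually_mem_nhdsWithin
  have hsm : ∀ᶠ ε in nhdsWithin (0:ℝ) (Ioi 0), ε < min t (c - t) :=
    nhdsWithin_le_nhds (eventually_lt_nhds (lt_min ht hB))
  have eα : ∀ᶠ ε in nhdsWithin (0:ℝ) (Ioi 0), 1 / 2 ≤ α ε := tα.eventually_const_le (by norm_num)
  have eγ : ∀ᶠ ε in nhdsWithin (0:ℝ) (Ioi 0), 1 / 2 ≤ γ ε := tγ.eventually_const_le (by norm_num)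
  have fα : ∀ᶠ ε in nhdsWithin (0:ℝ) (Ioi 0), ε / c ≤ 1 - α ε := by
    filter_upwards [hpos, hsm] with ε h0 h1
    have h2 := (lt_min_iff.1 h1).1
    have h3 : 0 < c - (t - ε) := by linarith
    have : 1 - α ε = c * ε / (t * (c - (t - ε))) := by simp only [hαdef]; field_simp; ring
    rw [this, div_le_div_iff₀ hc (by positivity)]
    have : t * (c - (t - ε)) ≤ c * c := by nlinarith
    nlinarith
  have fγ : ∀ᶠ ε in nhdsWithin (0:ℝ) (Ioi 0), ε / c ≤ 1 - γ ε := by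
    filter_upwards [hpos, hsm] with ε h0 h1
    have h2 := (lt_min_iff.1 h1).2
    have : 1 - γ ε = c * ε / ((t + ε) * (c - t)) := by simp only [hγdef]; field_simp; ring
    rw [this, div_le_div_iff₀ hc (by positivity)]
    have : (t + ε) * (c - t) ≤ c * c := by nlinarith
    nlinarith
  have fd : ∀ᶠ ε in nhdsWithin (0:ℝ) (Ioi 0), |α ε - γ ε| ≤ ε ^ 2 * (c ^ 2 / (t * (c - t)) ^ 2) := by
    filter_upwards [hpos, hsm] with ε h0 h1
    have h3 : 0 < c - (t - ε) := by linarith [(lt_min_iff.1 h1).1]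
    have : α ε - γ ε = ε ^ 2 * (c * (2 * t - c)  / ((t * (c - (t - ε))) * ((t + ε) * (c - t)))) := by
      simp only [hαdef, hγdef]; field_simp; ring
    rw [this, abs_mul, abs_of_pos (by positivity : 0 < ε ^ 2), abs_div, abs_mul, abs_of_pos hc,
      abs_of_pos (by positivity : 0 < (t * (c - (t - ε))) * ((t + ε) * (c - t)))]
    have k1 : |2 * t - c| ≤ c := by rw [abs_le]; constructor <;> linarith
    have k2 : t * (c - t) ≤ t * (c - (t - ε)) := by nlinarith
    have k3 : t * (c - t) ≤ (t + ε) * (c - t) := by nlinarith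
    rw [sq c, sq (t * (c - t))]
    gcongr
  have hK := aux_K_int a ha0 ha1
  have l1 : Tendsto (fun ε => ∫ x in (0:ℝ)..(α ε), (x ^ (a - 1) - x ^ (-a)) / (1 - x))
      (nhdsWithin 0 (Ioi 0)) (nhds (Real.pi / Real.tan (a * Real.pi))) := by
    rw [← aux_K_val a ha0 ha1, aux_II _ 1 zero_le_one]
    have hc := intervalIntegral.continuousOn_primitive_interval
      (f := fun x : ℝ => (x ^ (a - 1) - x ^ (-a)) / (1 - x)) (μ := volume) (a := 0) (b := 1)
      (by rw [uIcc_of_le zero_le_one, integrableOn_Icc_iff_integrableOn_Ioo]; exact hK)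
    have h1 := (hc 1 right_mem_uIcc).tendsto
    refine h1.comp (tendsto_nhdsWithin_iff.2 ⟨tα, ?_⟩)
    filter_upwards [eα, fα, hpos] with ε h1 h2 h3
    rw [uIcc_of_le zero_le_one]
    have : 0 < ε / c := by positivity
    constructor <;> linarith
  have l2 : Tendsto (fun ε => ∫ x in (γ ε)..(α ε), x ^ (-a) / (1 - x))
      (nhdsWithin 0 (Ioi 0)) (nhds 0) := by
    refine squeeze_zero_norm' (a := fun ε => ε * (2 * c * (c ^ 2 / (t * (c - t)) ^ 2))) ?_ ?_
    · filter_upwards [hpos, eα, eγ, fα, fγ, fd] with ε h0 h1 h2 h3 h4 h5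
      refine (aux_diff a _ _ (ε / c) ha0 ha1 (by positivity) h1 h2 h3 h4).trans ?_
      refine (mul_le_mul_of_nonneg_left h5 (by positivity)).trans (le_of_eq ?_)
      field_simp
    · have : Tendsto (fun ε : ℝ => ε * (2 * c * (c ^ 2 / (t * (c - t)) ^ 2))) (nhds 0) (nhds 0) := by
        have h : Continuous (fun ε : ℝ => ε * (2 * c * (c ^ 2 / (t * (c - t)) ^ 2))) := by fun_prop
        simpa using h.tendsto 0
      exact this.mono_left nhdsWithin_le_nhds
  have l3 := l1.add l2
  rw [add_zero] at l3
  refine l3.congr' ?_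
  filter_upwards [hpos, eα, eγ, fα, fγ] with ε h0 h1 h2 h3 h4
  have h5 : 0 < ε / c := by positivity
  rw [aux_II _ _ (by linarith), aux_II _ _ (by linarith)]
  have i1 := aux_piece_ii (a - 1) (α ε) (by linarith) (by linarith) (by linarith)
  have i2 := aux_piece_ii (-a) (α ε) (by linarith) (by linarith) (by linarith)
  have i3 := aux_piece_ii (-a) (γ ε) (by linarith) (by linarith) (by linarith)
  simp_rw [sub_div]
  rw [intervalIntegral.integral_sub i1 i2, ← intervalIntegral.integral_interval_sub_left i2 i3]
  ring

lemma aux_ind (a t c : ℝ) (S : Set ℝ) :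
    (∫ s in S, Set.indicator (Set.Ioo 0 c) (fun s => s ^ (-(1 - a)) * |c - s| ^ (-a)) s / (t - s)) =
      ∫ s in S ∩ Ioo 0 c, s ^ (-(1 - a)) * |c - s| ^ (-a) / (t - s) := by
  rw [← setIntegral_indicator measurableSet_Ioo]
  congr 1
  ext s
  by_cases hs : s ∈ Ioo 0 c <;> simp [hs]

theorem stmt12 (a t₀ : ℝ) (ha0 : 0 < a) (ha1 : a < 1) (ht₀ : t₀ ∈ Set.Ioo (0:ℝ) 1) :
    (∀ t ∈ Set.Ioo (0:ℝ) t₀,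
      pvIntegral (fun s => Set.indicator (Set.Ioo 0 t₀)
          (fun s => s ^ (-(1 - a)) * |t₀ - s| ^ (-a)) s) t
        (Real.pi / Real.tan (a * Real.pi) * (t ^ (-(1 - a)) * |t₀ - t| ^ (-a)))) ∧
    (∀ t ∈ Set.Ioo t₀ 1,
      pvIntegral (fun s => Set.indicator (Set.Ioo 0 t₀)
          (fun s => s ^ (-(1 - a)) * |t₀ - s| ^ (-a)) s) t
        (Real.pi / Real.sin (a * Real.pi) * (t ^ (-(1 - a)) * |t₀ - t| ^ (-a)))) := by
  have hpos : ∀ᶠ ε in nhdsWithin (0:ℝ) (Ioi 0), 0 < ε := eventually_mem_nhdsWithin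
  constructor
  · intro t ht
    have ht0 := ht.1
    have hB : 0 < t₀ - t := by linarith [ht.2]
    have hsm : ∀ᶠ ε in nhdsWithin (0:ℝ) (Ioi 0), ε < min t (t₀ - t) :=
      nhdsWithin_le_nhds (eventually_lt_nhds (lt_min ht.1 hB))
    refine ((aux_limit a t t₀ ha0 ha1 ht.1 ht.2).mul_const _).congr' ?_
    filter_upwards [hpos, hsm] with ε h0 h1
    obtain ⟨h2, h3⟩ := lt_min_iff.1 h1
    rw [aux_ind]
    have hset : (Ioo (0:ℝ) 1 \ Ioo (t - ε) (t + ε)) ∩ Ioo 0 t₀ = Ioc 0 (t - ε) ∪ Ico (t + ε) t₀ := by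
      ext s
      simp only [mem_inter_iff, Set.mem_sdiff, mem_Ioo, mem_union, mem_Ioc, mem_Ico, not_and, not_lt]
      have := ht₀.2
      constructor
      · rintro ⟨⟨⟨k1, k2⟩, k3⟩, k4, k5⟩
        rcases le_or_gt s (t - ε) with h | h
        · exact Or.inl ⟨k1, h⟩
        · exact Or.inr ⟨k3 h, k5⟩
      · rintro (⟨k1, k2⟩ | ⟨k1, k2⟩)
        · exact ⟨⟨⟨k1, by linarith⟩, fun h => by linarith⟩, k1, by linarith⟩
        · exact ⟨⟨⟨by linarith, by linarith⟩, fun h => k1⟩, by linarith, k2⟩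
    have q1 : 0 < t₀ - (t - ε) := by linarith
    have q2 : 0 < t₀ - (t + ε) := by linarith
    have q3 : 0 < t - ε := by linarith
    have L := aux_left a t t₀ (t - ε) ht.1 ht.2 (by linarith) (by linarith)
    have R := aux_right a t t₀ (t + ε) ht.1 (by linarith) (by linarith)
    have iL := L.2 (aux_piece_int (a - 1) _ (by linarith) (by positivity)
      (by rw [div_lt_one (by positivity)]; nlinarith))
    have iR := R.2 (aux_piece_int (-a) _ (by linarith) (by positivity)
      (by rw [div_lt_one (by positivity)]; nlinarith))
    rw [hset, setIntegral_union ?_ measurableSet_Ico ?_ ?_, integral_Ioc_eq_integral_Ioo,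
      integral_Ico_eq_integral_Ioo, L.1, R.1]
    · ring
    · rw [Set.disjoint_left]
      intro s k1 k2
      linarith [k1.2, k2.1]
    · rwa [integrableOn_Ioc_iff_integrableOn_Ioo]
    · rwa [integrableOn_Ico_iff_integrableOn_Ioo]
  · intro t ht
    have hsm : ∀ᶠ ε in nhdsWithin (0:ℝ) (Ioi 0), ε < t - t₀ :=
      nhdsWithin_le_nhds (eventually_lt_nhds (by linarith [ht.1]))
    refine tendsto_const_nhds.congr' ?_
    filter_upwards [hpos, hsm] with ε h0 h1
    have hset : (Ioo (0:ℝ) 1 \ Ioo (t - ε) (t + ε)) ∩ Ioo 0 t₀ = Ioo 0 t₀ := by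
      refine inter_eq_right.2 fun s hs => ⟨⟨hs.1, hs.2.trans ht₀.2⟩, fun h => ?_⟩
      linarith [h.1, hs.2]
    rw [aux_ind, hset, aux_out a t t₀ ht₀.1 ht.1, aux_beta a ha0 ha1]
    ring
end

section
/- For 0 < a < 1 and all t ∈ (0,1), the principal value integral p.v.∫₀¹ [(1−s)/s]^((1−a)/2) / (t−s) ds equals (π / cos(aπ/2)) · (1 − [(1−t)/t]^((1−a)/2) · sin(aπ/2)). -/
open Real MeasureTheory Filter Set

lemma cot_hasSum (b : ℝ) (hb0 : 0 < b) (hb1 : b < 1/2) :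
    HasSum (fun n : ℕ => 1 / ((n:ℝ) + b) - 1 / ((n:ℝ) + 1 - b))
      (π * Real.cos (π * b) / Real.sin (π * b)) := by
  have hn : ∀ n : ℕ, 0 ≤ 1 / ((n:ℝ) + b) - 1 / ((n:ℝ) + 1 - b) := by
    intro n
    have : (0:ℝ) ≤ n := n.cast_nonneg
    have := one_div_le_one_div_of_le (show 0 < (n:ℝ) + b by linarith)
      (show (n:ℝ) + b ≤ n + 1 - b by linarith)
    linarith
  rw [hasSum_iff_tendsto_nat_of_nonneg hn]
  have hx : (b : ℂ) ∈ Complex.integerComplement := by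
    rintro ⟨m, hm⟩
    have h : (m : ℝ) = b := by exact_mod_cast hm
    have h1 : (0:ℝ) < m := by rw [h]; exact hb0
    have h2 : (m:ℝ) < 1 := by rw [h]; linarith
    have h1' : 0 < m := by exact_mod_cast h1
    have h2' : m < 1 := by exact_mod_cast h2
    omega
  have h := tendsto_logDeriv_euler_cot_sub hx
  have h2 := (Complex.continuous_re.tendsto _).comp h
  have h3 : Tendsto (fun n : ℕ => 1 / ((n:ℝ) + b)) atTop (nhds 0) := by
    have : Tendsto (fun n : ℕ => ((n:ℝ) + b)) atTop atTop :=
      tendsto_atTop_add_const_right _ _ tendsto_natCast_atTop_atTop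
    simp only [one_div]
    exact this.inv_tendsto_atTop
  have hs : ∀ n : ℕ, ∑ i ∈ Finset.range n, (1 / ((i:ℝ) + b) - 1 / ((i:ℝ) + 1 - b))
      = 1 / b + (∑ j ∈ Finset.range n, cotTerm (b:ℂ) j).re - 1 / ((n:ℝ) + b) := by
    intro n
    induction n with
    | zero => simp
    | succ k ih =>
      rw [Finset.sum_range_succ, Finset.sum_range_succ, ih, Complex.add_re]
      have : (cotTerm (b:ℂ) k).re = 1 / (b - (k+1)) + 1 / (b + (k+1)) := by
        have : cotTerm (b:ℂ) k = ((1 / (b - (k+1)) + 1 / (b + (k+1)) : ℝ) : ℂ) := by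
          simp [cotTerm]
        rw [this, Complex.ofReal_re]
      rw [this]
      push_cast
      have e1 : 1 / (b - ((k:ℝ)+1)) = - (1 / ((k:ℝ) + 1 - b)) := by
        rw [← one_div_neg_eq_neg_one_div]; congr 1; ring
      rw [e1, show b + ((k:ℝ)+1) = k + 1 + b by ring]
      ring
  simp_rw [hs]
  have h4 := (h2.const_add (1/b)).sub h3
  have e : 1 / b + (π * Complex.cot (π * b) - 1 / (b:ℂ)).re - 0
      = π * Real.cos (π * b) / Real.sin (π * b) := by
    have : (π * Complex.cot (π * b) - 1 / (b:ℂ))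
      = ((π * (Real.cos (π * b) / Real.sin (π * b)) - 1 / b : ℝ) : ℂ) := by
      simp [Complex.cot]
    rw [this, Complex.ofReal_re]
    ring
  rw [e] at h4
  exact h4

lemma rpow_int (c : ℝ) (hc : -1 < c) : IntegrableOn (fun v : ℝ => v ^ c) (Ioc 0 1) := by
  have := intervalIntegral.intervalIntegrable_rpow' (a := 0) (b := 1) hc
  rwa [intervalIntegrable_iff_integrableOn_Ioc_of_le zero_le_one] at this

lemma rpow_val (c : ℝ) (hc : -1 < c) : ∫ v in Ioc (0:ℝ) 1, v ^ c = 1 / (c + 1) := by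
  rw [← intervalIntegral.integral_of_le zero_le_one, integral_rpow (Or.inl hc)]
  rw [Real.one_rpow, Real.zero_rpow (by linarith)]; simp

lemma H_int (b : ℝ) (hb0 : 0 < b) (hb1 : b < 1/2) :
    IntegrableOn (fun v : ℝ => (v ^ (b-1) - v ^ (-b)) / (1 - v)) (Ioc 0 1) := by
  refine (rpow_int (b-1) (by linarith)).mono' ?_ ?_
  · exact (by fun_prop : Measurable fun v : ℝ => (v ^ (b-1) - v ^ (-b)) / (1 - v)).aestronglyMeasurable
  · refine (ae_restrict_iff' measurableSet_Ioc).2 (ae_of_all _ ?_)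
    rintro v ⟨h0, h1⟩
    rcases h1.eq_or_lt with rfl | h1
    · simp
    have hv : 0 < 1 - v := by linarith
    have hp : 0 < v ^ (b-1) := Real.rpow_pos_of_pos h0 _
    have e : v ^ (-b) = v ^ (b-1) * v ^ (1-2*b) := by
      rw [← Real.rpow_add h0]; congr 1; ring
    have k1 : v ^ (1-2*b) ≤ 1 := Real.rpow_le_one h0.le h1.le (by linarith)
    have k2 : v ≤ v ^ (1-2*b) := by
      simpa using Real.rpow_le_rpow_of_exponent_ge h0 h1.le (show 1-2*b ≤ 1 by linarith)
    rw [Real.norm_eq_abs, e, abs_of_nonneg, div_le_iff₀ hv]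
    · nlinarith
    · apply div_nonneg _ hv.le
      nlinarith

lemma H_val (b : ℝ) (hb0 : 0 < b) (hb1 : b < 1/2) :
    ∫ v in Ioc (0:ℝ) 1, (v ^ (b-1) - v ^ (-b)) / (1 - v)
      = π * Real.cos (π * b) / Real.sin (π * b) := by
  have hc := cot_hasSum b hb0 hb1
  have i1 : ∀ n : ℕ, IntegrableOn (fun v : ℝ => v ^ ((n:ℝ) + b-1)) (Ioc 0 1) := fun n =>
    rpow_int _ (by have : (0:ℝ) ≤ n := n.cast_nonneg; linarith)
  have i2 : ∀ n : ℕ, IntegrableOn (fun v : ℝ => v ^ ((n:ℝ) - b)) (Ioc 0 1) := fun n =>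
    rpow_int _ (by have : (0:ℝ) ≤ n := n.cast_nonneg; linarith)
  have iv : ∀ n : ℕ, ∫ v in Ioc (0:ℝ) 1, (v ^ ((n:ℝ) + b-1) - v ^ ((n:ℝ) - b))
      = 1 / ((n:ℝ) + b) - 1 / ((n:ℝ) + 1 - b) := by
    intro n
    have : (0:ℝ) ≤ n := n.cast_nonneg
    rw [integral_sub (i1 n) (i2 n), rpow_val _ (by linarith), rpow_val _ (by linarith)]
    congr 2 <;> ring
  have hnn : ∀ n : ℕ, ∀ v ∈ Ioc (0:ℝ) 1, 0 ≤ v ^ ((n:ℝ) + b-1) - v ^ ((n:ℝ) - b) := by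
    rintro n v ⟨h0, h1⟩
    have := Real.rpow_le_rpow_of_exponent_ge h0 h1 (show (n:ℝ) + b - 1 ≤ n - b by linarith)
    linarith
  have hs := hasSum_integral_of_summable_integral_norm
    (F := fun (n : ℕ) (v : ℝ) => v ^ ((n:ℝ) + b-1) - v ^ ((n:ℝ) - b))
    (μ := volume.restrict (Ioc (0:ℝ) 1)) (fun n => (i1 n).sub (i2 n)) (by
      refine hc.summable.congr ?_
      intro n
      rw [← iv n]
      refine setIntegral_congr_fun measurableSet_Ioc ?_
      intro v hv
      exact (Real.norm_of_nonneg (hnn n v hv)).symm)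
  simp_rw [iv] at hs
  rw [← hs.unique hc]
  rw [integral_Ioc_eq_integral_Ioo, integral_Ioc_eq_integral_Ioo]
  refine setIntegral_congr_fun measurableSet_Ioo ?_
  rintro v ⟨h0, h1⟩
  have g := (hasSum_geometric_of_lt_one h0.le h1).mul_left (v ^ (b-1) - v ^ (-b))
  have g2 : (fun n : ℕ => v ^ ((n:ℝ) + b-1) - v ^ ((n:ℝ) - b)) =
      fun n : ℕ => (v ^ (b-1) - v ^ (-b)) * v ^ n := by
    funext n
    rw [← Real.rpow_natCast v n, sub_mul, ← Real.rpow_add h0, ← Real.rpow_add h0]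
    congr 2 <;> ring
  simp only [g2, g.tsum_eq]
  rfl

lemma beta_int (b : ℝ) (hb0 : 0 < b) (hb1 : b < 1/2) :
    IntegrableOn (fun s : ℝ => s ^ (-b) * (1 - s) ^ (b-1)) (Ioo 0 1) ∧
    ∫ s in Ioo (0:ℝ) 1, s ^ (-b) * (1 - s) ^ (b-1) = π / Real.sin (π * b) := by
  have h := Complex.betaIntegral_convergent (u := ((1 - b : ℝ) : ℂ)) (v := (b : ℂ))
    (by simp; linarith) (by simpa)
  rw [intervalIntegrable_iff_integrableOn_Ioo_of_le zero_le_one] at h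
  have e : ∀ s ∈ Ioo (0:ℝ) 1, (s:ℂ) ^ (((1-b:ℝ):ℂ) - 1) * (1 - (s:ℂ)) ^ ((b:ℂ) - 1)
      = ((s ^ (-b) * (1 - s) ^ (b-1) : ℝ) : ℂ) := by
    rintro s ⟨h0, h1⟩
    rw [Complex.ofReal_mul, Complex.ofReal_cpow h0.le, Complex.ofReal_cpow (by linarith)]
    push_cast
    congr 2
    ring
  have h' := (integrableOn_congr_fun e measurableSet_Ioo).1 h
  refine ⟨by simpa [IntegrableOn] using h'.re, ?_⟩
  have hb := ProbabilityTheory.beta_eq_betaIntegralReal (1-b) b (by linarith) hb0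
  rw [Complex.betaIntegral, intervalIntegral.integral_of_le zero_le_one,
    integral_Ioc_eq_integral_Ioo, setIntegral_congr_fun measurableSet_Ioo e,
    integral_complex_ofReal, Complex.ofReal_re] at hb
  rw [← hb, ProbabilityTheory.beta, mul_comm, Real.Gamma_mul_Gamma_one_sub]
  simp

/-- change of variables left of the singularity -/
lemma cov_left (b t q : ℝ) (ht : t ∈ Ioo (0:ℝ) 1) (hq0 : 0 < q) (hq1 : q < 1) :
    ∫ s in Ioc 0 (q / ((1-t)/t + q)), (1 - t) * (s ^ (-b) * (1 - s) ^ (b-1)) / (t - s)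
      = ((1-t)/t)^b * ∫ v in Ioc 0 q, v ^ (-b) / (1 - v) := by
  obtain ⟨t0, t1⟩ := ht
  obtain ⟨T, hTd⟩ : ∃ T, T = (1-t)/t := ⟨_, rfl⟩
  have hT : 0 < T := by rw [hTd]; exact div_pos (by linarith) t0
  have htT : t = 1 / (1 + T) := by rw [hTd]; field_simp; ring
  rw [← hTd]
  have him : (fun v : ℝ => v / (T + v)) '' (Ioc 0 q) = Ioc 0 (q / (T + q)) := by
    ext s
    simp only [mem_image, mem_Ioc]
    constructor
    · rintro ⟨v, ⟨h0, h1⟩, rfl⟩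
      refine ⟨by positivity, ?_⟩
      rw [div_le_div_iff₀ (by positivity) (by positivity)]
      nlinarith
    · rintro ⟨h0, h1⟩
      have hs1 : s < 1 := lt_of_le_of_lt h1 (by rw [div_lt_one (by positivity)]; linarith)
      have hs : 0 < 1 - s := by linarith
      refine ⟨T * s / (1 - s), ⟨by positivity, ?_⟩, ?_⟩
      · rw [le_div_iff₀ (by positivity)] at h1
        rw [div_le_iff₀ hs]
        nlinarith
      · have : T + T * s / (1 - s) ≠ 0 := by positivity
        field_simp
        ring
  rw [← him, integral_image_eq_integral_abs_deriv_smul (f' := fun v => T / (T + v)^2)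
    measurableSet_Ioc, ← integral_const_mul]
  · refine setIntegral_congr_fun measurableSet_Ioc ?_
    rintro v ⟨h0, h1⟩
    have hv1 : 0 < 1 - v := by linarith
    have hTv : 0 < T + v := by positivity
    have e1 : 1 - v / (T + v) = T / (T + v) := by field_simp; ring
    have e2 : t - v / (T + v) = T * (1 - v) / ((1 + T) * (T + v)) := by
      rw [htT]; field_simp; ring
    have e3 : 1 - t = T / (1 + T) := by rw [htT]; field_simp; ring
    simp only [smul_eq_mul]
    rw [abs_of_pos (by positivity), e1, e2, e3, Real.div_rpow h0.le hTv.le,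
      Real.div_rpow hT.le hTv.le, Real.rpow_sub_one hT.ne', Real.rpow_sub_one hTv.ne',
      Real.rpow_neg hTv.le]
    have := Real.rpow_pos_of_pos hTv b
    field_simp
  · rintro v ⟨h0, h1⟩
    have hTv : T + v ≠ 0 := by positivity
    have := ((hasDerivAt_id v).div ((hasDerivAt_id v).const_add T) hTv).hasDerivWithinAt (s := Ioc 0 q)
    convert! this using 1
    simp
  · rintro v ⟨h0, h1⟩ w ⟨h2, h3⟩ h
    simp only at h
    rw [div_eq_div_iff (by positivity) (by positivity)] at h
    have : T * (v - w) = 0 := by linarith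
    rcases mul_eq_zero.1 this with h | h <;> linarith

/-- change of variables right of the singularity -/
lemma cov_right (b t p : ℝ) (ht : t ∈ Ioo (0:ℝ) 1) (hq0 : 0 < p) (hq1 : p < 1) :
    ∫ s in Ico (1 / (1 + (1-t)/t * p)) 1, (1 - t) * (s ^ (-b) * (1 - s) ^ (b-1)) / (t - s)
      = - (((1-t)/t)^b * ∫ v in Ioc 0 p, v ^ (b-1) / (1 - v)) := by
  obtain ⟨t0, t1⟩ := ht
  obtain ⟨T, hTd⟩ : ∃ T, T = (1-t)/t := ⟨_, rfl⟩
  have hT : 0 < T := by rw [hTd]; exact div_pos (by linarith) t0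
  have htT : t = 1 / (1 + T) := by rw [hTd]; field_simp; ring
  rw [← hTd]
  have him : (fun v : ℝ => 1 / (1 + T * v)) '' (Ioc 0 p) = Ico (1 / (1 + T * p)) 1 := by
    ext s
    simp only [mem_image, mem_Ioc, mem_Ico]
    constructor
    · rintro ⟨v, ⟨h0, h1⟩, rfl⟩
      have : 0 < T * v := by positivity
      refine ⟨?_, ?_⟩
      · apply one_div_le_one_div_of_le (by positivity)
        nlinarith
      · rw [div_lt_one (by positivity)]; linarith
    · rintro ⟨h0, h1⟩
      have hs0 : 0 < s := lt_of_lt_of_le (by positivity) h0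
      have hs : 0 < 1 - s := by linarith
      refine ⟨(1 - s) / (s * T), ⟨by positivity, ?_⟩, ?_⟩
      · rw [div_le_iff₀ (by positivity)] at h0
        rw [div_le_iff₀ (by positivity)]
        nlinarith
      · have : 1 + T * ((1 - s) / (s * T)) ≠ 0 := by positivity
        field_simp
        ring
  rw [← him, integral_image_eq_integral_abs_deriv_smul (f' := fun v => - T / (1 + T * v)^2)
    measurableSet_Ioc, ← integral_const_mul, ← integral_neg]
  · refine setIntegral_congr_fun measurableSet_Ioc ?_
    rintro v ⟨h0, h1⟩
    have hv1 : 0 < 1 - v := by linarith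
    have hTv : 0 < 1 + T * v := by positivity
    have e1 : 1 - 1 / (1 + T * v) = (T * v) / (1 + T * v) := by field_simp; ring
    have e2 : t - 1 / (1 + T * v) = - (T * (1 - v) / ((1 + T) * (1 + T * v))) := by
      rw [htT]; field_simp; ring
    have e3 : 1 - t = T / (1 + T) := by rw [htT]; field_simp; ring
    have e4 : |-T / (1 + T * v)^2| = T / (1 + T * v)^2 := by
      rw [neg_div, abs_neg, abs_of_pos (by positivity)]
    simp only [smul_eq_mul]
    rw [e4, e1, e2, e3, Real.div_rpow zero_le_one hTv.le,
      Real.div_rpow (by positivity) hTv.le, Real.mul_rpow hT.le h0.le, Real.rpow_sub_one hT.ne',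
      Real.rpow_sub_one hTv.ne', Real.rpow_neg hTv.le, Real.one_rpow]
    have := Real.rpow_pos_of_pos hTv b
    field_simp
  · rintro v ⟨h0, h1⟩
    have hTv : 1 + T * v ≠ 0 := by positivity
    have := (((hasDerivAt_id v).const_mul T).const_add 1).inv hTv
    have := this.hasDerivWithinAt (s := Ioc 0 p)
    convert! this using 1
    · funext x; simp
    · simp
  · rintro v ⟨h0, h1⟩ w ⟨h2, h3⟩ h
    simp only at h
    rw [div_eq_div_iff (by positivity) (by positivity)] at h
    have : T * (v - w) = 0 := by linarith
    rcases mul_eq_zero.1 this with h | h <;> linarith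

lemma G_int (c : ℝ) (hc : -1 < c) (q : ℝ) (hq1 : q < 1) :
    IntegrableOn (fun v : ℝ => v ^ c / (1 - v)) (Ioc 0 q) := by
  have h1 : IntegrableOn (fun v : ℝ => v ^ c) (Ioc 0 q) := by
    rcases le_or_gt q 0 with h | h
    · simp [Ioc_eq_empty (not_lt.2 h)]
    have := intervalIntegral.intervalIntegrable_rpow' (a := 0) (b := q) hc
    rwa [intervalIntegrable_iff_integrableOn_Ioc_of_le h.le] at this
  refine (h1.mul_const (1 / (1 - q))).mono' ?_ ?_
  · exact (by fun_prop : Measurable fun v : ℝ => v ^ c / (1 - v)).aestronglyMeasurable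
  · refine (ae_restrict_iff' measurableSet_Ioc).2 (ae_of_all _ ?_)
    rintro v ⟨h0, h1⟩
    have hv : 0 < 1 - v := by linarith
    have hp : 0 < v ^ c := Real.rpow_pos_of_pos h0 _
    rw [Real.norm_of_nonneg (by positivity), mul_one_div]
    exact div_le_div_of_nonneg_left hp.le (by linarith) (by linarith)

/-- the error caused by an asymmetric cut tends to zero -/
lemma err_bound (b p q : ℝ) (hb0 : 0 < b) (hb1 : b < 1/2) (hp0 : 1/2 ≤ p) (hp1 : p < 1)
    (hq0 : 1/2 ≤ q) (hq1 : q < 1) :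
    |(∫ v in Ioc 0 q, v ^ (-b) / (1 - v)) - ∫ v in Ioc 0 p, v ^ (-b) / (1 - v)|
      ≤ 2 * (|q - p| / (1 - p) + |q - p| / (1 - q)) := by
  have ip := G_int (-b) (by linarith) p hp1
  have iq := G_int (-b) (by linarith) q hq1
  rw [← intervalIntegrable_iff_integrableOn_Ioc_of_le (by linarith)] at ip iq
  rw [← intervalIntegral.integral_of_le (by linarith), ← intervalIntegral.integral_of_le (by linarith),
    intervalIntegral.integral_interval_sub_left iq ip]
  have hp : 0 < 1 - p := by linarith
  have hq : 0 < 1 - q := by linarith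
  have := intervalIntegral.norm_integral_le_of_norm_le_const (a := p) (b := q)
    (f := fun v : ℝ => v ^ (-b) / (1 - v)) (C := 2 * (1 / (1 - p) + 1 / (1 - q))) (by
      intro v hv
      rw [mem_uIoc] at hv
      have hv0 : 1/2 ≤ v := by rcases hv with h | h <;> linarith
      have hv1 : 0 < 1 - v := by rcases hv with h | h <;> linarith
      have k1 : v ^ (-b) ≤ 2 := by
        have a1 : v ^ (-b) ≤ v ^ (-1 : ℝ) :=
          Real.rpow_le_rpow_of_exponent_ge (by linarith) (by linarith) (by linarith)
        rw [Real.rpow_neg_one] at a1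
        have : v⁻¹ ≤ 2 := by rw [inv_le_comm₀ (by linarith) (by norm_num)]; linarith
        linarith
      have k0 : 0 ≤ v ^ (-b) := Real.rpow_nonneg (by linarith) _
      have k2 : 1 / (1 - v) ≤ 1 / (1 - p) + 1 / (1 - q) := by
        have z1 : 0 < 1 / (1 - p) := by positivity
        have z2 : 0 < 1 / (1 - q) := by positivity
        rcases hv with h | h
        · have := one_div_le_one_div_of_le hq (show 1 - q ≤ 1 - v by linarith)
          linarith
        · have := one_div_le_one_div_of_le hp (show 1 - p ≤ 1 - v by linarith)
          linarith
      rw [Real.norm_of_nonneg (by positivity), div_eq_mul_one_div]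
      exact mul_le_mul k1 k2 (by positivity) (by norm_num))
  rw [Real.norm_eq_abs] at this
  refine this.trans (le_of_eq ?_)
  ring

lemma beta_cut (K : ℝ → ℝ) (t : ℝ) (ht : t ∈ Ioo (0:ℝ) 1) (hK : IntegrableOn K (Ioo 0 1)) :
    Tendsto (fun ε : ℝ => ∫ s in Ioo (0:ℝ) 1 \ Ioo (t - ε) (t + ε), K s)
      (nhdsWithin 0 (Ioi 0)) (nhds (∫ s in Ioo (0:ℝ) 1, K s)) := by
  obtain ⟨t0, t1⟩ := ht
  have hm : Tendsto ((volume.restrict (Ioo (0:ℝ) 1)) ∘ fun ε : ℝ => Ioo (t - ε) (t + ε))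
      (nhdsWithin 0 (Ioi 0)) (nhds 0) := by
    have h2 : Tendsto (fun ε : ℝ => ENNReal.ofReal (2 * ε)) (nhdsWithin 0 (Ioi 0)) (nhds 0) := by
      have : Continuous (fun ε : ℝ => ENNReal.ofReal (2 * ε)) :=
        ENNReal.continuous_ofReal.comp (by fun_prop)
      have := (this.tendsto 0).mono_left (nhdsWithin_le_nhds (s := Ioi 0))
      simpa using this
    refine tendsto_of_tendsto_of_tendsto_of_le_of_le tendsto_const_nhds h2
      (fun _ => zero_le) (fun ε => ?_)
    refine (Measure.restrict_apply_le _ _).trans ?_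
    rw [Real.volume_Ioo]
    apply le_of_eq
    congr 1; ring
  have h := (Integrable.tendsto_setIntegral_nhds_zero (μ := volume.restrict (Ioo (0:ℝ) 1)) hK hm)
  have h3 := h.const_sub (∫ s in Ioo (0:ℝ) 1, K s)
  rw [sub_zero] at h3
  refine h3.congr' ?_
  have hev : ∀ᶠ ε : ℝ in nhdsWithin 0 (Ioi 0), ε < min t (1 - t) :=
    (eventually_lt_nhds (lt_min t0 (by linarith))).filter_mono nhdsWithin_le_nhds
  filter_upwards [hev] with ε hε
  have e1 := hε.trans_le (min_le_left _ _)
  have e2 := hε.trans_le (min_le_right _ _)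
  have hsub : Ioo (t - ε) (t + ε) ⊆ Ioo (0:ℝ) 1 := by
    rintro s ⟨h0, h1⟩; constructor <;> linarith
  rw [setIntegral_sdiff₀ measurableSet_Ioo.nullMeasurableSet hK hsub,
    Measure.restrict_restrict measurableSet_Ioo, inter_eq_left.2 hsub]

lemma cut_formula (b t ε : ℝ) (hb0 : 0 < b) (hb1 : b < 1/2) (ht : t ∈ Ioo (0:ℝ) 1)
    (hε : 0 < ε) (e1 : ε < t) (e2 : ε < 1 - t) :
    ∫ s in Ioo (0:ℝ) 1 \ Ioo (t - ε) (t + ε), ((1 - s) / s) ^ b / (t - s)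
    = (∫ s in Ioo (0:ℝ) 1 \ Ioo (t - ε) (t + ε), s ^ (-b) * (1 - s) ^ (b-1))
      + ((1-t)/t)^b * (((∫ v in Ioc 0 ((1-t)*(t-ε)/(t*(1-t+ε))), v ^ (-b) / (1 - v))
        - ∫ v in Ioc 0 ((1-t-ε)*t/((t+ε)*(1-t))), v ^ (-b) / (1 - v))
        - ∫ v in Ioc 0 ((1-t-ε)*t/((t+ε)*(1-t))), (v ^ (b-1) - v ^ (-b)) / (1 - v)) := by
  have ht' := ht
  obtain ⟨t0, t1⟩ := ht'
  have k1 : 0 < 1 - t := by linarith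
  have k2 : 0 < t - ε := by linarith
  have k3 : 0 < 1 - t - ε := by linarith
  obtain ⟨q, hq⟩ : ∃ q, q = (1-t)*(t-ε)/(t*(1-t+ε)) := ⟨_, rfl⟩
  obtain ⟨p, hp⟩ : ∃ p, p = (1-t-ε)*t/((t+ε)*(1-t)) := ⟨_, rfl⟩
  rw [← hq, ← hp]
  have q0 : 0 < q := by rw [hq]; positivity
  have p0 : 0 < p := by rw [hp]; positivity
  have q1 : q < 1 := by rw [hq, div_lt_one (by positivity)]; nlinarith
  have p1 : p < 1 := by rw [hp, div_lt_one (by positivity)]; nlinarith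
  have eq : q / ((1-t)/t + q) = t - ε := by
    have : (1-t)/t + q ≠ 0 := by positivity
    rw [div_eq_iff this, hq]
    field_simp
    ring
  have ep : 1 / (1 + (1-t)/t * p) = t + ε := by
    have : 1 + (1-t)/t * p ≠ 0 := by positivity
    rw [div_eq_iff this, hp]
    field_simp
    ring
  have hD : Ioo (0:ℝ) 1 \ Ioo (t - ε) (t + ε) = Ioc 0 (t - ε) ∪ Ico (t + ε) 1 := by
    ext s
    simp only [Set.mem_sdiff, mem_Ioo, mem_union, mem_Ioc, mem_Ico, not_and, not_lt]
    constructor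
    · rintro ⟨⟨a1, a2⟩, a3⟩
      rcases le_or_gt s (t - ε) with h | h
      · exact Or.inl ⟨a1, h⟩
      · exact Or.inr ⟨a3 h, a2⟩
    · rintro (⟨a1, a2⟩ | ⟨a1, a2⟩)
      · exact ⟨⟨a1, by linarith⟩, fun h => by linarith⟩
      · exact ⟨⟨by linarith, a2⟩, fun h => a1⟩
  have hDm : MeasurableSet (Ioo (0:ℝ) 1 \ Ioo (t - ε) (t + ε)) := measurableSet_Ioo.diff measurableSet_Ioo
  have hK := (beta_int b hb0 hb1).1.mono_set (sdiff_subset (t := Ioo (t - ε) (t + ε)))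
  have hg : IntegrableOn (fun s => (1 - t) * (s ^ (-b) * (1 - s) ^ (b-1)) / (t - s))
      (Ioo (0:ℝ) 1 \ Ioo (t - ε) (t + ε)) := by
    refine (hK.mul_const ((1 - t) / ε)).mono' ?_ ?_
    · exact (by fun_prop : Measurable fun s : ℝ =>
        (1 - t) * (s ^ (-b) * (1 - s) ^ (b-1)) / (t - s)).aestronglyMeasurable
    · refine (ae_restrict_iff' hDm).2 (ae_of_all _ ?_)
      rintro s ⟨⟨s0, s1⟩, hs⟩
      have hs2 : ε ≤ |t - s| := by
        by_contra! h
        rw [abs_lt] at h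
        exact hs ⟨by linarith, by linarith⟩
      have hs' : 0 < 1 - s := by linarith
      have m1 : 0 ≤ s ^ (-b) * (1 - s) ^ (b-1) := by positivity
      rw [norm_div, Real.norm_eq_abs (t - s), Real.norm_of_nonneg (by positivity)]
      refine (div_le_div_of_nonneg_left (by positivity) hε hs2).trans (le_of_eq ?_)
      ring
  have s1 : ∫ s in Ioo (0:ℝ) 1 \ Ioo (t - ε) (t + ε), ((1 - s) / s) ^ b / (t - s)
    = (∫ s in Ioo (0:ℝ) 1 \ Ioo (t - ε) (t + ε), s ^ (-b) * (1 - s) ^ (b-1))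
     + ∫ s in Ioo (0:ℝ) 1 \ Ioo (t - ε) (t + ε), (1 - t) * (s ^ (-b) * (1 - s) ^ (b-1)) / (t - s) := by
    rw [← integral_add hK hg]
    refine setIntegral_congr_fun hDm ?_
    rintro s ⟨⟨s0, s1⟩, hs⟩
    have hts : t - s ≠ 0 := by
      intro h
      exact hs ⟨by linarith, by linarith⟩
    have hs' : 0 < 1 - s := by linarith
    simp only
    rw [Real.div_rpow hs'.le s0.le, Real.rpow_sub_one hs'.ne', Real.rpow_neg s0.le]
    have := Real.rpow_pos_of_pos s0 b
    field_simp
    ring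
  have hH : ∫ v in Ioc 0 p, (v ^ (b-1) - v ^ (-b)) / (1 - v)
      = (∫ v in Ioc 0 p, v ^ (b-1) / (1 - v)) - ∫ v in Ioc 0 p, v ^ (-b) / (1 - v) := by
    rw [← integral_sub (G_int _ (by linarith) _ p1) (G_int _ (by linarith) _ p1)]
    simp_rw [sub_div]
  rw [s1, hH]
  congr 1
  rw [hD] at hg ⊢
  rw [setIntegral_union _ measurableSet_Ico hg.left_of_union hg.right_of_union]
  · have c1 := cov_left b t q ht q0 q1
    have c2 := cov_right b t p ht p0 p1
    rw [eq] at c1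
    rw [ep] at c2
    rw [c1, c2]
    ring
  · rw [Set.disjoint_left]
    rintro s ⟨_, h1⟩ ⟨h2, _⟩
    linarith

lemma pv_main (b t : ℝ) (hb0 : 0 < b) (hb1 : b < 1/2) (ht : t ∈ Ioo (0:ℝ) 1) :
    Tendsto (fun ε : ℝ => ∫ s in Ioo (0:ℝ) 1 \ Ioo (t - ε) (t + ε), ((1 - s) / s) ^ b / (t - s))
      (nhdsWithin 0 (Ioi 0))
      (nhds (π / Real.sin (π * b) + ((1-t)/t)^b * (0 - π * Real.cos (π * b) / Real.sin (π * b)))) := by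
  have ht' := ht
  obtain ⟨t0, t1⟩ := ht'
  have k1 : 0 < 1 - t := by linarith
  obtain ⟨hK, hKv⟩ := beta_int b hb0 hb1
  have hev : ∀ᶠ ε : ℝ in nhdsWithin 0 (Ioi 0), ε < min t (1 - t) :=
    (eventually_lt_nhds (lt_min t0 (by linarith))).filter_mono nhdsWithin_le_nhds
  have hpos : ∀ᶠ ε : ℝ in nhdsWithin 0 (Ioi 0), 0 < ε := self_mem_nhdsWithin
  have hqt : Tendsto (fun ε : ℝ => (1-t)*(t-ε)/(t*(1-t+ε))) (nhdsWithin 0 (Ioi 0)) (nhds 1) := by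
    have : ContinuousAt (fun ε : ℝ => (1-t)*(t-ε)/(t*(1-t+ε))) 0 :=
      ContinuousAt.div (by fun_prop) (by fun_prop) (by simp; constructor <;> linarith)
    have := this.tendsto.mono_left (nhdsWithin_le_nhds (s := Ioi 0))
    convert! this using 2
    simp; field_simp
  have hpt : Tendsto (fun ε : ℝ => (1-t-ε)*t/((t+ε)*(1-t))) (nhdsWithin 0 (Ioi 0)) (nhds 1) := by
    have : ContinuousAt (fun ε : ℝ => (1-t-ε)*t/((t+ε)*(1-t))) 0 :=
      ContinuousAt.div (by fun_prop) (by fun_prop) (by simp; constructor <;> linarith)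
    have := this.tendsto.mono_left (nhdsWithin_le_nhds (s := Ioi 0))
    convert! this using 2
    simp; field_simp
  have hlt : ∀ᶠ ε : ℝ in nhdsWithin 0 (Ioi 0), (1-t)*(t-ε)/(t*(1-t+ε)) < 1 ∧
      (1-t-ε)*t/((t+ε)*(1-t)) < 1 := by
    filter_upwards [hpos] with ε hε
    constructor
    · rw [div_lt_one (by positivity)]; nlinarith
    · rw [div_lt_one (by positivity)]; nlinarith
  have hA := beta_cut _ t ht hK
  rw [hKv] at hA
  have hC : Tendsto (fun ε : ℝ => ∫ v in Ioc 0 ((1-t-ε)*t/((t+ε)*(1-t))),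
      (v ^ (b-1) - v ^ (-b)) / (1 - v)) (nhdsWithin 0 (Ioi 0))
      (nhds (π * Real.cos (π * b) / Real.sin (π * b))) := by
    have hHi := H_int b hb0 hb1
    have hc := intervalIntegral.continuousOn_primitive (μ := volume) (a := (0:ℝ)) (b := 1)
      ((integrableOn_Icc_iff_integrableOn_Ioc (by simp)).2 hHi)
    have h1 := (hc 1 (by simp)).tendsto
    rw [H_val b hb0 hb1] at h1
    refine h1.comp (tendsto_nhdsWithin_iff.2 ⟨hpt, ?_⟩)
    filter_upwards [hlt, hpt.eventually (lt_mem_nhds (show (0:ℝ) < 1 by norm_num))] with ε h h'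
    exact ⟨h'.le, h.2.le⟩
  have hB : Tendsto (fun ε : ℝ => (∫ v in Ioc 0 ((1-t)*(t-ε)/(t*(1-t+ε))), v ^ (-b) / (1 - v))
        - ∫ v in Ioc 0 ((1-t-ε)*t/((t+ε)*(1-t))), v ^ (-b) / (1 - v))
        (nhdsWithin 0 (Ioi 0)) (nhds 0) := by
    have hbd : Tendsto (fun ε : ℝ => 2 * (|1 - (t+ε)*(1-t)/(t*(1-t+ε))| +
        |t*(1-t+ε)/((t+ε)*(1-t)) - 1|)) (nhdsWithin 0 (Ioi 0)) (nhds 0) := by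
      have c1 : ContinuousAt (fun ε : ℝ => (t+ε)*(1-t)/(t*(1-t+ε))) 0 :=
        ContinuousAt.div (by fun_prop) (by fun_prop) (by simp; constructor <;> linarith)
      have c2 : ContinuousAt (fun ε : ℝ => t*(1-t+ε)/((t+ε)*(1-t))) 0 :=
        ContinuousAt.div (by fun_prop) (by fun_prop) (by simp; constructor <;> linarith)
      have : ContinuousAt (fun ε : ℝ => 2 * (|1 - (t+ε)*(1-t)/(t*(1-t+ε))| +
        |t*(1-t+ε)/((t+ε)*(1-t)) - 1|)) 0 :=
        ((c1.const_sub 1).abs.add (c2.sub_const 1).abs).const_mul 2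
      have := this.tendsto.mono_left (nhdsWithin_le_nhds (s := Ioi 0))
      convert! this using 2
      have : t * (1 - t) ≠ 0 := by positivity
      simp [div_self this]
    refine squeeze_zero_norm' ?_ hbd
    filter_upwards [hlt, hpos, hpt.eventually (lt_mem_nhds (show (1/2:ℝ) < 1 by norm_num)),
      hqt.eventually (lt_mem_nhds (show (1/2:ℝ) < 1 by norm_num))] with ε h1 hε h2 h3
    rw [Real.norm_eq_abs]
    refine (err_bound b _ _ hb0 hb1 h2.le h1.2 h3.le h1.1).trans (le_of_eq ?_)
    have y1 : 0 < 1 - (1-t-ε)*t/((t+ε)*(1-t)) := by linarith [h1.2]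
    have y2 : 0 < 1 - (1-t)*(t-ε)/(t*(1-t+ε)) := by linarith [h1.1]
    have z1 : 1 - (1-t-ε)*t/((t+ε)*(1-t)) = ε / ((t+ε)*(1-t)) := by field_simp; ring
    have z2 : 1 - (1-t)*(t-ε)/(t*(1-t+ε)) = ε / (t*(1-t+ε)) := by field_simp; ring
    have z3 : (1-t)*(t-ε)/(t*(1-t+ε)) - (1-t-ε)*t/((t+ε)*(1-t))
      = ε / ((t+ε)*(1-t)) - ε / (t*(1-t+ε)) := by rw [← z1, ← z2]; ring
    rw [z1] at y1 ⊢
    rw [z2] at y2 ⊢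
    rw [z3, ← abs_of_pos y1, ← abs_of_pos y2, ← abs_div, ← abs_div, abs_of_pos y1, abs_of_pos y2]
    congr 3
    · congr 1
      field_simp
    · congr 1
      field_simp
  refine (hA.add ((hB.sub hC).const_mul (((1-t)/t)^b))).congr' ?_
  filter_upwards [hev, hpos] with ε h1 h2
  exact (cut_formula b t ε hb0 hb1 ht h2 (h1.trans_le (min_le_left _ _))
    (h1.trans_le (min_le_right _ _))).symm

theorem stmt13 (a : ℝ) (ha0 : 0 < a) (ha1 : a < 1) :
    ∀ t ∈ Set.Ioo (0:ℝ) 1,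
      pvIntegral (fun s => ((1 - s) / s) ^ ((1 - a) / 2)) t
        (Real.pi / Real.cos (a * Real.pi / 2) *
          (1 - ((1 - t) / t) ^ ((1 - a) / 2) * Real.sin (a * Real.pi / 2))) := by
  intro t ht
  have h := pv_main ((1 - a) / 2) t (by linarith) (by linarith) ht
  have e1 : Real.sin (π * ((1 - a) / 2)) = Real.cos (a * Real.pi / 2) := by
    rw [← Real.sin_pi_div_two_sub]; congr 1; ring
  have e2 : Real.cos (π * ((1 - a) / 2)) = Real.sin (a * Real.pi / 2) := by
    rw [← Real.cos_pi_div_two_sub]; congr 1; ring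
  rw [e1, e2] at h
  unfold pvIntegral
  convert! h using 2
  ring
end

section
/- Let 0 < a < 1, let 𝒞_a(A + Bt) denote the function t ↦ (cos(aπ/2)/(π φ_a(t))) · ((B/a)t + A − ((1−a)/(2a))B), where φ_a(t) = [t(1−t)]^((1−a)/2). Then for every A, B ∈ ℝ, u := 𝒞_a(A+Bt) satisfies ∫₀¹ |t−s|^(−a) u(s) ds = A + Bt for all t ∈ (0,1). -/
open Real MeasureTheory Set

lemma beta_aux {u v : ℝ} (hu : 0 < u) (hv : 0 < v) :
    IntegrableOn (fun x : ℝ => x ^ (u - 1) * (1 - x) ^ (v - 1)) (Ioo 0 1) ∧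
    ∫ x in Ioo (0:ℝ) 1, x ^ (u - 1) * (1 - x) ^ (v - 1) =
      Real.Gamma u * Real.Gamma v / Real.Gamma (u + v) := by
  have hc := Complex.betaIntegral_convergent (u := u) (v := v) (by simpa) (by simpa)
  rw [intervalIntegrable_iff_integrableOn_Ioo_of_le (by simp)] at hc
  have hre : EqOn (fun x : ℝ => RCLike.re ((x : ℂ) ^ ((u:ℂ) - 1) * (1 - (x : ℂ)) ^ ((v:ℂ) - 1)))
      (fun x : ℝ => x ^ (u - 1) * (1 - x) ^ (v - 1)) (Ioo 0 1) := by
    intro x hx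
    simp only
    norm_cast
    rw [← Complex.ofReal_cpow hx.1.le, ← Complex.ofReal_cpow (by linarith [hx.2])]
    rw [RCLike.re_to_complex, Complex.re_mul_ofReal, Complex.ofReal_re]
  refine ⟨IntegrableOn.congr_fun (Integrable.re hc) hre measurableSet_Ioo, ?_⟩
  rw [← setIntegral_congr_fun measurableSet_Ioo hre, integral_re hc]
  have := ProbabilityTheory.beta_eq_betaIntegralReal u v hu hv
  rw [Complex.betaIntegral, intervalIntegral.integral_of_le (by norm_num),
      integral_Ioc_eq_integral_Ioo, ← RCLike.re_to_complex] at this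
  rw [← this, ProbabilityTheory.beta]

noncomputable def carQ (t x : ℝ) : ℝ := √((1 - x) * (1 - x + 4 * x * t * (1 - t)))
noncomputable def carS (t x : ℝ) : ℝ := (1 - x + 2 * x * t - carQ t x) / 2
noncomputable def carW (t x : ℝ) : ℝ := (t - carS t x) / carQ t x
noncomputable def carX (t s : ℝ) : ℝ := s * (1 - s) / (s + t ^ 2 - 2 * s * t)

lemma car_N {t s : ℝ} (hs : s ∈ Ioo 0 t) (ht : t < 1) : 0 < s + t ^ 2 - 2 * s * t := by
  have := hs.1; have := hs.2
  nlinarith [sq_nonneg (t - s), mul_pos hs.1 (by linarith : 0 < 1 - s)]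

lemma car_M {t s : ℝ} (hs : s ∈ Ioo 0 t) (ht : t < 1) : 0 < s + t - 2 * s * t := by
  have := hs.1; have := hs.2
  nlinarith [mul_pos hs.1 (by linarith : 0 < 1 - t), mul_pos (by linarith : 0 < t) (by linarith : 0 < 1 - s)]

lemma car_Qpos {t x : ℝ} (ht : t ∈ Ioo (0:ℝ) 1) (hx : x ∈ Ioo (0:ℝ) 1) :
    0 < carQ t x ∧ carQ t x ^ 2 = (1 - x) * (1 - x + 4 * x * t * (1 - t)) := by
  have h1 : 0 < 1 - x := by linarith [hx.2]
  have h2 : 0 < 1 - t := by linarith [ht.2]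
  have h3 := hx.1
  have h4 := ht.1
  have : 0 < (1 - x) * (1 - x + 4 * x * t * (1 - t)) := by positivity
  exact ⟨Real.sqrt_pos.2 this, Real.sq_sqrt this.le⟩

lemma car_S_mem {t x : ℝ} (ht : t ∈ Ioo (0:ℝ) 1) (hx : x ∈ Ioo (0:ℝ) 1) :
    carS t x ∈ Ioo 0 t := by
  obtain ⟨h0, h1⟩ := car_Qpos ht hx
  have hx1 : 0 < 1 - x := by linarith [hx.2]
  have ht1 : 0 < 1 - t := by linarith [ht.2]
  have hx0 := hx.1
  have ht0 := ht.1
  unfold carS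
  constructor
  · have : carQ t x < 1 - x + 2 * x * t := by
      apply lt_of_pow_lt_pow_left₀ 2 (by positivity)
      rw [h1]
      have : 0 < x * t ^ 2 := by positivity
      nlinarith
    linarith
  · have : (1 - x) * (1 - 2 * t) < carQ t x := by
      apply lt_of_pow_lt_pow_left₀ 2 h0.le
      rw [h1]
      have : 0 < (1 - x) * (t * (1 - t)) := by positivity
      nlinarith
    linarith

lemma car_X_S {t x : ℝ} (ht : t ∈ Ioo (0:ℝ) 1) (hx : x ∈ Ioo (0:ℝ) 1) :
    carX t (carS t x) = x := by
  obtain ⟨h0, h1⟩ := car_Qpos ht hx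
  have := car_N (car_S_mem ht hx) ht.2
  rw [carX, div_eq_iff this.ne']
  unfold carS
  linear_combination (-1/4) * h1

lemma car_one_sub_X {t s : ℝ} (ht : t < 1) (hs : s ∈ Ioo 0 t) :
    1 - carX t s = (t - s) ^ 2 / (s + t ^ 2 - 2 * s * t) := by
  have h1 := car_N hs ht
  unfold carX
  obtain ⟨N, hN⟩ : ∃ N, N = s + t ^ 2 - 2 * s * t := ⟨_, rfl⟩
  rw [← hN] at h1 ⊢
  field_simp
  rw [hN]
  ring

lemma car_Q_X {t s : ℝ} (ht : t < 1) (hs : s ∈ Ioo 0 t) :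
    carQ t (carX t s) = (t - s) * (s + t - 2 * s * t) / (s + t ^ 2 - 2 * s * t) := by
  have h1 := car_N hs ht
  have h2 := car_M hs ht
  have h3 : 0 < t - s := by linarith [hs.2]
  rw [carQ, Real.sqrt_eq_iff_mul_self_eq_of_pos (by positivity)]
  unfold carX
  obtain ⟨N, hN⟩ : ∃ N, N = s + t ^ 2 - 2 * s * t := ⟨_, rfl⟩
  rw [← hN] at h1 ⊢
  field_simp
  rw [hN]
  ring

lemma car_S_X {t s : ℝ} (ht : t < 1) (hs : s ∈ Ioo 0 t) :
    carS t (carX t s) = s := by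
  have h1 := car_N hs ht
  rw [carS, car_Q_X ht hs]
  unfold carX
  obtain ⟨N, hN⟩ : ∃ N, N = s + t ^ 2 - 2 * s * t := ⟨_, rfl⟩
  rw [← hN] at h1 ⊢
  field_simp
  rw [hN]
  ring

lemma car_W_X {t s : ℝ} (ht : t < 1) (hs : s ∈ Ioo 0 t) :
    carW t (carX t s) = (s + t ^ 2 - 2 * s * t) / (s + t - 2 * s * t) := by
  have h1 := car_N hs ht
  have h2 := car_M hs ht
  have h3 : 0 < t - s := by linarith [hs.2]
  rw [carW, car_Q_X ht hs, car_S_X ht hs]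
  field_simp

lemma car_X_mem {t s : ℝ} (ht : t < 1) (hs : s ∈ Ioo 0 t) : carX t s ∈ Ioo (0:ℝ) 1 := by
  have h1 := car_N hs ht
  have h3 : 0 < t - s := by linarith [hs.2]
  have h4 : 0 < 1 - s := by linarith [hs.2]
  have h5 := hs.1
  constructor
  · unfold carX; positivity
  · have := car_one_sub_X ht hs
    have : 0 < 1 - carX t s := by rw [this]; positivity
    linarith

lemma car_image {t : ℝ} (ht : t ∈ Ioo (0:ℝ) 1) : carX t '' Ioo 0 t = Ioo 0 1 := by
  ext x
  constructor
  · rintro ⟨s, hs, rfl⟩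
    exact car_X_mem ht.2 hs
  · intro hx
    exact ⟨carS t x, car_S_mem ht hx, car_X_S ht hx⟩

lemma car_injOn {t : ℝ} (ht : t ∈ Ioo (0:ℝ) 1) : InjOn (carX t) (Ioo 0 t) := by
  intro s hs s' hs' h
  rw [← car_S_X ht.2 hs, h, car_S_X ht.2 hs']

lemma car_deriv {t s : ℝ} (ht : t < 1) (hs : s ∈ Ioo 0 t) :
    HasDerivAt (carX t) ((s + t - 2 * s * t) * (t - s) / (s + t ^ 2 - 2 * s * t) ^ 2) s := by
  have h1 := car_N hs ht
  have ha : HasDerivAt (fun s : ℝ => s * (1 - s)) (1 * (1 - s) + s * (0 - 1)) s :=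
    (hasDerivAt_id s).mul ((hasDerivAt_const s (1:ℝ)).sub (hasDerivAt_id s))
  have hb : HasDerivAt (fun s : ℝ => s + t ^ 2 - 2 * s * t) (1 - 2 * 1 * t) s :=
    ((hasDerivAt_id s).add_const (t ^ 2)).sub (((hasDerivAt_id s).const_mul 2).mul_const t)
  refine (ha.div hb h1.ne').congr_deriv ?_
  congr 1
  ring

/-- weights add to one -/
lemma car_W_add {t x : ℝ} (ht : t ∈ Ioo (0:ℝ) 1) (hx : x ∈ Ioo (0:ℝ) 1) (p q : ℝ) :
    carW t x * (p * carS t x + q) + carW (1 - t) x * (p * (1 - carS (1 - t) x) + q) =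
      p * (x * t + (1 - x) * (1 - t)) + q := by
  obtain ⟨h0, h1⟩ := car_Qpos ht hx
  have hq : carQ (1 - t) x = carQ t x := by
    unfold carQ; congr 1; ring
  unfold carW carS
  rw [hq]
  field_simp
  ring

lemma car_W_bound {t x : ℝ} (ht : t ∈ Ioo (0:ℝ) 1) (hx : x ∈ Ioo (0:ℝ) 1) :
    0 ≤ carW t x ∧ carW t x ≤ 1 := by
  have key : ∀ t ∈ Ioo (0:ℝ) 1, 0 ≤ carW t x := by
    intro t ht
    have := (car_S_mem ht hx).2
    exact div_nonneg (by linarith) (car_Qpos ht hx).1.le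
  have h1 := car_W_add ht hx 0 1
  have h2 := key (1 - t) ⟨by linarith [ht.2], by linarith [ht.1]⟩
  exact ⟨key t ht, by linarith⟩

lemma car_meas (t : ℝ) : Measurable (carS t) ∧ Measurable (carW t) := by
  have h : Measurable (carQ t) := by unfold carQ; fun_prop
  have h1 : Measurable (carS t) := by unfold carS; fun_prop
  refine ⟨h1, ?_⟩
  unfold carW; fun_prop

lemma car_branch {t b : ℝ} (ht : t ∈ Ioo (0:ℝ) 1) (hb0 : 0 < b) (hb1 : b < 1) (p q : ℝ) :
    IntegrableOn (fun x : ℝ => x ^ (-b) * (1 - x) ^ (b - 1) * (carW t x * (p * carS t x + q)))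
      (Ioo 0 1) ∧
    IntegrableOn (fun s : ℝ => |t - s| ^ (2 * b - 1) * ((s * (1 - s)) ^ (-b) * (p * s + q)))
      (Ioo 0 t) ∧
    ∫ s in Ioo 0 t, |t - s| ^ (2 * b - 1) * ((s * (1 - s)) ^ (-b) * (p * s + q)) =
      ∫ x in Ioo (0:ℝ) 1, x ^ (-b) * (1 - x) ^ (b - 1) * (carW t x * (p * carS t x + q)) := by
  obtain ⟨hmS, hmW⟩ := car_meas t
  have hi : IntegrableOn (fun x : ℝ => x ^ (-b) * (1 - x) ^ (b - 1) *
      (carW t x * (p * carS t x + q))) (Ioo 0 1) := by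
    have h0 := (beta_aux (u := 1 - b) (v := b) (by linarith) hb0).1
    rw [show (1 - b - 1 : ℝ) = -b by ring] at h0
    refine Integrable.mul_bdd (c := |p| + |q|) h0 (by fun_prop) ?_
    refine ae_restrict_of_forall_mem measurableSet_Ioo fun x hx => ?_
    have hW := car_W_bound ht hx
    have hS := car_S_mem ht hx
    have hS1 : |carS t x| ≤ 1 := by
      rw [abs_of_pos hS.1]; linarith [hS.2, ht.2]
    rw [norm_mul, Real.norm_eq_abs, Real.norm_eq_abs, abs_of_nonneg hW.1]
    have h3 : |p * carS t x + q| ≤ |p| + |q| := by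
      refine (abs_add_le _ _).trans ?_
      rw [abs_mul]
      have := mul_le_mul_of_nonneg_left hS1 (abs_nonneg p)
      linarith
    have := mul_le_mul hW.2 h3 (abs_nonneg _) zero_le_one
    linarith
  have hcongr : EqOn (fun s : ℝ => |(s + t - 2 * s * t) * (t - s) / (s + t ^ 2 - 2 * s * t) ^ 2| •
      ((carX t s) ^ (-b) * (1 - carX t s) ^ (b - 1) *
        (carW t (carX t s) * (p * carS t (carX t s) + q))))
      (fun s : ℝ => |t - s| ^ (2 * b - 1) * ((s * (1 - s)) ^ (-b) * (p * s + q))) (Ioo 0 t) := by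
    intro s hs
    have h1 := car_N hs ht.2
    have h2 := car_M hs ht.2
    have h3 : 0 < t - s := by linarith [hs.2]
    have h4 : 0 < 1 - s := by linarith [hs.2, ht.2]
    have h5 := hs.1
    simp only [smul_eq_mul]
    rw [car_W_X ht.2 hs, car_S_X ht.2 hs, car_one_sub_X ht.2 hs, carX, abs_of_pos (by positivity),
      abs_of_pos h3, Real.div_rpow (by positivity) h1.le, Real.div_rpow (by positivity) h1.le,
      ← Real.rpow_natCast (t - s) 2, ← Real.rpow_mul h3.le]
    set N := s + t ^ 2 - 2 * s * t
    set M := s + t - 2 * s * t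
    have e1 : (t - s) ^ (2 * b - 1) = (t - s) ^ ((2:ℕ) * (b - 1)) * (t - s) := by
      rw [← Real.rpow_add_one h3.ne']; congr 1; push_cast; ring
    have e2 : N ^ (-b) * N ^ (b - 1) = N⁻¹ := by
      rw [← Real.rpow_add h1, ← Real.rpow_neg_one]; congr 1; ring
    have p1 : 0 < N ^ (-b) := Real.rpow_pos_of_pos h1 _
    have p2 : 0 < N ^ (b - 1) := Real.rpow_pos_of_pos h1 _
    rw [e1]
    have e3 : N * (N ^ (-b) * N ^ (b - 1)) = 1 := by rw [e2]; field_simp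
    field_simp
    linear_combination (-(p * s + q)) * e3
  have hd : ∀ s ∈ Ioo 0 t, HasDerivWithinAt (carX t)
      ((s + t - 2 * s * t) * (t - s) / (s + t ^ 2 - 2 * s * t) ^ 2) (Ioo 0 t) s :=
    fun s hs => (car_deriv ht.2 hs).hasDerivWithinAt
  refine ⟨hi, ?_, ?_⟩
  · rw [← car_image ht, integrableOn_image_iff_integrableOn_abs_deriv_smul measurableSet_Ioo hd
      (car_injOn ht)] at hi
    exact hi.congr_fun hcongr measurableSet_Ioo
  · rw [← car_image ht, integral_image_eq_integral_abs_deriv_smul measurableSet_Ioo hd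
      (car_injOn ht)]
    exact (setIntegral_congr_fun measurableSet_Ioo hcongr).symm

lemma car_refl {t : ℝ} (g h : ℝ → ℝ) (hgh : ∀ s, g s = h (1 - s))
    (hi : IntegrableOn g (Ioo 0 (1 - t))) :
    IntegrableOn h (Ioo t 1) ∧ ∫ s in Ioo t 1, h s = ∫ s in Ioo 0 (1 - t), g s := by
  have him : (fun s : ℝ => 1 - s) '' Ioo 0 (1 - t) = Ioo t 1 := by simp
  have hd : ∀ s ∈ Ioo 0 (1 - t), HasDerivWithinAt (fun s : ℝ => 1 - s) (-1) (Ioo 0 (1 - t)) s :=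
    fun s _ => by simpa using ((hasDerivAt_id s).const_sub 1).hasDerivWithinAt
  have hinj : InjOn (fun s : ℝ => 1 - s) (Ioo 0 (1 - t)) := fun x _ y _ hxy => by
    simp only at hxy; linarith
  have hg : g = fun s => |(-1:ℝ)| • h (1 - s) := by ext s; simp [hgh]
  constructor
  · rw [← him, integrableOn_image_iff_integrableOn_abs_deriv_smul measurableSet_Ioo hd hinj, ← hg]
    exact hi
  · rw [← him, integral_image_eq_integral_abs_deriv_smul measurableSet_Ioo hd hinj, ← hg]

lemma car_main {t b : ℝ} (ht : t ∈ Ioo (0:ℝ) 1) (hb0 : 0 < b) (hb1 : b < 1) (p q : ℝ) :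
    ∫ s in Ioo (0:ℝ) 1, |t - s| ^ (2 * b - 1) * ((s * (1 - s)) ^ (-b) * (p * s + q)) =
      π / sin (π * b) * (p * (b + (1 - 2 * b) * t) + q) := by
  have ht' : 1 - t ∈ Ioo (0:ℝ) 1 := ⟨by linarith [ht.2], by linarith [ht.1]⟩
  obtain ⟨i1, j1, k1⟩ := car_branch ht hb0 hb1 p q
  obtain ⟨i2, j2, k2⟩ := car_branch ht' hb0 hb1 (-p) (p + q)
  obtain ⟨l1, l2⟩ := car_refl (t := t) _
    (fun s : ℝ => |t - s| ^ (2 * b - 1) * ((s * (1 - s)) ^ (-b) * (p * s + q))) (fun s => by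
      rw [show t - (1 - s) = -(1 - t - s) by ring, abs_neg]
      rw [show (1 - s) * (1 - (1 - s)) = s * (1 - s) by ring,
        show p * (1 - s) + q = -p * s + (p + q) by ring]) j2
  have hsplit : Ioo (0:ℝ) 1 =ᵐ[volume] (Ioo 0 t ∪ Ioo t 1 : Set ℝ) := by
    rw [← Ioc_union_Ioo_eq_Ioo ht.1.le ht.2]
    exact (Ioo_ae_eq_Ioc.symm).union (ae_eq_refl _)
  rw [setIntegral_congr_set hsplit, setIntegral_union _ measurableSet_Ioo j1 l1, l2, k1, k2,
    ← integral_add i1 i2]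
  swap
  · rw [Set.disjoint_left]; intro x hx hx'; exact absurd hx.2 (not_lt.2 hx'.1.le)
  obtain ⟨m1, n1⟩ := beta_aux (u := 2 - b) (v := b) (by linarith) hb0
  obtain ⟨m2, n2⟩ := beta_aux (u := 1 - b) (v := 1 + b) (by linarith) (by linarith)
  have hΓ := Real.Gamma_mul_Gamma_one_sub b
  have g2 : Real.Gamma 2 = 1 := by simp
  have gb : Real.Gamma (2 - b) = (1 - b) * Real.Gamma (1 - b) := by
    rw [← Real.Gamma_add_one (by linarith)]; congr 1; ring
  have gc : Real.Gamma (1 + b) = b * Real.Gamma b := by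
    rw [← Real.Gamma_add_one hb0.ne']; congr 1; ring
  rw [show 2 - b + b = 2 by ring, g2, gb] at n1
  rw [show 1 - b + (1 + b) = 2 by ring, g2, gc] at n2
  have hfin : EqOn (fun x : ℝ => x ^ (-b) * (1 - x) ^ (b - 1) * (carW t x * (p * carS t x + q)) +
      x ^ (-b) * (1 - x) ^ (b - 1) * (carW (1 - t) x * (-p * carS (1 - t) x + (p + q))))
      (fun x : ℝ => (p * t + q) * (x ^ (2 - b - 1) * (1 - x) ^ (b - 1)) +
        (p * (1 - t) + q) * (x ^ (1 - b - 1) * (1 - x) ^ (1 + b - 1))) (Ioo 0 1) := by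
    intro x hx
    have h := car_W_add ht hx p q
    have e1 : x ^ (2 - b - 1) = x ^ (-b) * x := by
      rw [← Real.rpow_add_one hx.1.ne']; congr 1; ring
    have e2 : (1 - x) ^ (1 + b - 1) = (1 - x) ^ (b - 1) * (1 - x) := by
      rw [← Real.rpow_add_one (by linarith [hx.2])]; congr 1; ring
    simp only
    rw [e1, e2, show 1 - b - 1 = -b by ring]
    linear_combination (x ^ (-b) * (1 - x) ^ (b - 1)) * h
  rw [setIntegral_congr_fun measurableSet_Ioo hfin, integral_add (m1.const_mul _) (m2.const_mul _),
    integral_const_mul, integral_const_mul, n1, n2, ← hΓ]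
  ring

theorem stmt15 (a A B : ℝ) (ha0 : 0 < a) (ha1 : a < 1) :
    ∀ t ∈ Set.Ioo (0:ℝ) 1,
      ∫ s in Set.Ioo (0:ℝ) 1, |t - s| ^ (-a) *
        (Real.cos (a * Real.pi / 2) / (Real.pi * (s * (1 - s)) ^ ((1 - a) / 2)) *
          ((B / a) * s + (A - (1 - a) / (2 * a) * B))) = A + B * t := by
  intro t ht
  have h := car_main ht (b := (1 - a) / 2) (by linarith) (by linarith) (B / a)
    (A - (1 - a) / (2 * a) * B)
  have hs : sin (π * ((1 - a) / 2)) = cos (a * π / 2) := by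
    rw [← Real.sin_pi_div_two_sub]; congr 1; ring
  have hc : 0 < cos (a * π / 2) := by
    apply Real.cos_pos_of_mem_Ioo
    constructor <;> nlinarith [Real.pi_pos]
  rw [hs] at h
  have hcg : EqOn (fun s : ℝ => |t - s| ^ (-a) *
        (Real.cos (a * Real.pi / 2) / (Real.pi * (s * (1 - s)) ^ ((1 - a) / 2)) *
          ((B / a) * s + (A - (1 - a) / (2 * a) * B))))
      (fun s : ℝ => cos (a * π / 2) / π * (|t - s| ^ (2 * ((1 - a) / 2) - 1) *
        ((s * (1 - s)) ^ (-((1 - a) / 2)) * ((B / a) * s + (A - (1 - a) / (2 * a) * B)))))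
      (Ioo 0 1) := by
    intro s hs
    simp only
    rw [Real.rpow_neg (mul_nonneg hs.1.le (by linarith [hs.2])),
      show 2 * ((1 - a) / 2) - 1 = -a by ring, div_mul_eq_div_mul_one_div, one_div]
    ring
  rw [setIntegral_congr_fun measurableSet_Ioo hcg, integral_const_mul, h]
  have := Real.pi_pos
  field_simp
  ring
end
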